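/- (Existence and uniqueness of global solutions.) Assume hypotheses (H1)–(H3), let q0, q be chosen with 1 − 1/p < 1/q0 < min{β, δα, δ/p, 1/2} and 1/(q0·δ) ≤ 1/q < min{α, 1/p}, let ω : [0,T] → ℝ^m be continuous of finite p-variation, let t0 ∈ [0,T), and let x_{t0} ∈ ℝ^d. Then the Young differential equation x_t = x_{t0} + ∫_{t0}^t f(s,x_s) ds + ∫_{t0}^t g(s,x_s) dω_s, t ∈ [t0,T], has a unique solution x in the space of continuous paths of finite q-variation on [t0,T]. Moreover, this solution has finite p'-variation on [t0,T], where p' := max{p, 1/α}. -/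

import Mathlib

open scoped BigOperators
open Set

noncomputable section

/-- Euclidean space `ℝ^n`. -/
abbrev Ed (n : ℕ) : Type := EuclideanSpace ℝ (Fin n)

section PVarDefs

variable {E F : Type*} [NormedAddCommGroup E] [NormedSpace ℝ E]
  [NormedAddCommGroup F] [NormedSpace ℝ F]

/-- The set of sums `Σ_i ‖x (t (i+1)) - x (t i)‖ ^ p` over all finite partitions
`a = t 0 < t 1 < ⋯ < t n = b` of `[a,b]`. -/
def pVarSums (p : ℝ) (x : ℝ → E) (a b : ℝ) : Set ℝ :=
  { v | ∃ n : ℕ, ∃ t : Fin (n + 1) → ℝ, StrictMono t ∧ t 0 = a ∧ t (Fin.last n) = b ∧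
      v = ∑ i : Fin n, ‖x (t i.succ) - x (t i.castSucc)‖ ^ p }

/-- The `p`-variation seminorm `|||x|||_{p-var,[a,b]}`. -/
def pVar (p : ℝ) (x : ℝ → E) (a b : ℝ) : ℝ :=
  sSup (pVarSums p x a b) ^ (1 / p)

/-- `x` is of finite `p`-variation on `[a,b]`. -/
def FinitePVar (p : ℝ) (x : ℝ → E) (a b : ℝ) : Prop :=
  BddAbove (pVarSums p x a b)

/-- The `p`-variation norm `‖x‖_{p-var,[a,b]} = ‖x a‖ + |||x|||_{p-var,[a,b]}`. -/
def pVarNorm (p : ℝ) (x : ℝ → E) (a b : ℝ) : ℝ :=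
  ‖x a‖ + pVar p x a b

/-- A control function on `[a,b]`: continuous on the simplex, vanishing on the diagonal,
superadditive and nonnegative. -/
def IsControlOn (a b : ℝ) (w : ℝ → ℝ → ℝ) : Prop :=
  ContinuousOn (fun pr : ℝ × ℝ => w pr.1 pr.2) {pr : ℝ × ℝ | a ≤ pr.1 ∧ pr.1 ≤ pr.2 ∧ pr.2 ≤ b} ∧
  (∀ t : ℝ, a ≤ t → t ≤ b → w t t = 0) ∧
  (∀ s t u : ℝ, a ≤ s → s ≤ t → t ≤ u → u ≤ b → w s t + w t u ≤ w s u) ∧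
  (∀ s t : ℝ, a ≤ s → s ≤ t → t ≤ b → 0 ≤ w s t)

/-- A tagged partition `a = t 0 < t 1 < ⋯ < t n = b` of `[a,b]`, with tags
`tag i ∈ [t i, t (i+1)]`. -/
structure TaggedPartition (a b : ℝ) where
  n : ℕ
  t : Fin (n + 1) → ℝ
  tag : Fin n → ℝ
  mono : StrictMono t
  first : t 0 = a
  last : t (Fin.last n) = b
  tag_mem : ∀ i : Fin n, tag i ∈ Set.Icc (t i.castSucc) (t i.succ)

/-- The mesh of a tagged partition. -/
def TaggedPartition.mesh {a b : ℝ} (P : TaggedPartition a b) : ℝ :=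
  ⨆ i : Fin P.n, (P.t i.succ - P.t i.castSucc)

/-- Riemann–Stieltjes sum of `x` against `ω` along a tagged partition. -/
def RSSum (x : ℝ → E →L[ℝ] F) (ω : ℝ → E) {a b : ℝ} (P : TaggedPartition a b) : F :=
  ∑ i : Fin P.n, x (P.tag i) (ω (P.t i.succ) - ω (P.t i.castSucc))

/-- `v` is the Young integral `∫_a^b x dω`: the Riemann–Stieltjes sums converge to `v`
as the mesh tends to `0`. -/
def IsYoungIntegral (x : ℝ → E →L[ℝ] F) (ω : ℝ → E) (a b : ℝ) (v : F) : Prop :=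
  ∀ ε : ℝ, 0 < ε → ∃ δ : ℝ, 0 < δ ∧
    ∀ P : TaggedPartition a b, P.mesh < δ → ‖RSSum x ω P - v‖ < ε

/-- The Young integral `∫_a^b x dω` (an arbitrary value, `0`, if the limit does not exist). -/
def youngIntegral (x : ℝ → E →L[ℝ] F) (ω : ℝ → E) (a b : ℝ) : F :=
  letI := Classical.propDecidable (∃ v, IsYoungIntegral x ω a b v)
  if hv : ∃ v, IsYoungIntegral x ω a b v then hv.choose else 0

end PVarDefs

/-- `x` is a solution on `[t0,T1]` of the Young differential equation
`x t = x0 + ∫_{t0}^t f(s, x s) ds + ∫_{t0}^t g(s, x s) dω_s`, in the space of continuous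
paths of finite `q`-variation. -/
def IsSolutionOn {d m : ℕ} (f : ℝ → Ed d → Ed d) (g : ℝ → Ed d → (Ed m →L[ℝ] Ed d))
    (ω : ℝ → Ed m) (q t0 T1 : ℝ) (x0 : Ed d) (x : ℝ → Ed d) : Prop :=
  ContinuousOn x (Set.Icc t0 T1) ∧ FinitePVar q x t0 T1 ∧ x t0 = x0 ∧
    ∀ t ∈ Set.Icc t0 T1,
      x t = x0 + (∫ s in t0..t, f s (x s)) + youngIntegral (fun s => g s (x s)) ω t0 t

lemma rpow_le_mul_rpow {x M e e' : ℝ} (hx : 0 ≤ x) (hxM : x ≤ M) (he : e' ≤ e) (he' : 0 < e') :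
    x ^ e ≤ M ^ (e - e') * x ^ e' := by
  rcases hx.eq_or_lt with rfl | hx
  · rw [Real.zero_rpow (by linarith), Real.zero_rpow he'.ne', mul_zero]
  · have : x ^ e = x ^ (e - e') * x ^ e' := by
      rw [← Real.rpow_add hx]; congr 1; ring
    rw [this]
    gcongr

/-- A family of bounds improved by an affine contraction self-improves to its fixed point. -/
lemma le_of_contract {c K N₀ X Y : ℝ} (hc0 : 0 ≤ c) (hc : c < 1) (hK : 0 ≤ K) {P : ℝ → Prop}
    (hN₀ : 0 ≤ N₀) (h0 : P N₀) (hstep : ∀ N, 0 ≤ N → P N → P (c * N + K))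
    (hX : ∀ N, P N → X ≤ N * Y) : X ≤ K / (1 - c) * Y := by
  have hc' : 0 < 1 - c := by linarith
  have key : ∀ k : ℕ, ∃ N, 0 ≤ N ∧ P N ∧ N = K / (1 - c) + c ^ k * (N₀ - K / (1 - c)) := by
    intro k
    induction k with
    | zero => exact ⟨N₀, hN₀, h0, by simp⟩
    | succ k ih =>
      obtain ⟨N, hN, hPN, hNe⟩ := ih
      refine ⟨c * N + K, by positivity, hstep N hN hPN, ?_⟩
      rw [hNe, pow_succ]
      field_simp
      ring
  have hlim : Filter.Tendsto (fun k : ℕ => (K / (1 - c) + c ^ k * (N₀ - K / (1 - c))) * Y)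
      Filter.atTop (nhds ((K / (1 - c) + 0 * (N₀ - K / (1 - c))) * Y)) :=
    (((tendsto_pow_atTop_nhds_zero_of_lt_one hc0 hc).mul_const _).const_add _).mul_const _
  have := ge_of_tendsto' hlim (fun k => by
    obtain ⟨N, -, hPN, hNe⟩ := key k
    rw [← hNe]
    exact hX N hPN)
  simpa using this

/-- The constant of the sewing lemma. -/
def sewC (θ : ℝ) : ℝ := 2 / (1 - 2 ^ (1 - θ))

lemma two_rpow_lt_one {θ : ℝ} (hθ : 1 < θ) : (2 : ℝ) ^ (1 - θ) < 1 :=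
  Real.rpow_lt_one_of_one_lt_of_neg (by norm_num) (by linarith)

lemma sewC_pos {θ : ℝ} (hθ : 1 < θ) : 0 < sewC θ :=
  div_pos two_pos (by linarith [two_rpow_lt_one hθ])

/-- Sewing estimate: a two-parameter function that vanishes on the middle piece of suitable
splittings is controlled by its defect of additivity. -/
lemma sewing_bound {F : Type*} [NormedAddCommGroup F] {S : Set ℝ} {τ : ℝ → ℝ} {J : ℝ → ℝ → F}
    {θ K N₀ : ℝ} (hθ : 1 < θ) (hK : 0 ≤ K) (hN₀ : 0 ≤ N₀) (hτ : MonotoneOn τ S)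
    (hsplit : ∀ s ∈ S, ∀ t ∈ S, s < t → ∃ u ∈ S, ∃ v ∈ S, s ≤ u ∧ u ≤ v ∧ v ≤ t ∧
      τ u - τ s ≤ (τ t - τ s) / 2 ∧ τ t - τ v ≤ (τ t - τ s) / 2 ∧ J u v = 0)
    (hδ : ∀ s ∈ S, ∀ u ∈ S, ∀ t ∈ S, s ≤ u → u ≤ t →
      ‖J s t - J s u - J u t‖ ≤ K * (τ t - τ s) ^ θ)
    (h0 : ∀ s ∈ S, ∀ t ∈ S, s ≤ t → ‖J s t‖ ≤ N₀ * (τ t - τ s) ^ θ) :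
    ∀ s ∈ S, ∀ t ∈ S, s ≤ t → ‖J s t‖ ≤ sewC θ * K * (τ t - τ s) ^ θ := by
  intro s₀ hs₀ t₀ ht₀ hst₀
  have hmain := le_of_contract (c := 2 ^ (1 - θ)) (K := 2 * K) (N₀ := N₀) (X := ‖J s₀ t₀‖)
    (Y := (τ t₀ - τ s₀) ^ θ)
    (P := fun N => ∀ s ∈ S, ∀ t ∈ S, s ≤ t → ‖J s t‖ ≤ N * (τ t - τ s) ^ θ)
    (by positivity) (two_rpow_lt_one hθ) (by positivity) hN₀ h0 ?_
    (fun N hN => hN s₀ hs₀ t₀ ht₀ hst₀)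
  · refine hmain.trans_eq ?_
    unfold sewC
    ring
  · intro N hN hP s hs t ht hst
    rcases hst.eq_or_lt with rfl | hst
    · have := h0 s hs s hs le_rfl
      rw [sub_self, Real.zero_rpow (by linarith), mul_zero] at this ⊢
      exact this
    obtain ⟨u, hu, v, hv, hsu, huv, hvt, h1, h2, h3⟩ := hsplit s hs t ht hst
    have hw : 0 ≤ τ t - τ s := sub_nonneg.2 (hτ hs ht hst.le)
    have e1 := hδ s hs u hu t ht hsu (huv.trans hvt)
    have e2 := hδ u hu v hv t ht huv hvt
    have e3 := hP s hs u hu hsu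
    have e4 := hP v hv t ht hvt
    have m1 : (τ u - τ s) ^ θ ≤ ((τ t - τ s) / 2) ^ θ :=
      Real.rpow_le_rpow (sub_nonneg.2 (hτ hs hu hsu)) h1 (by linarith)
    have m2 : (τ t - τ v) ^ θ ≤ ((τ t - τ s) / 2) ^ θ :=
      Real.rpow_le_rpow (sub_nonneg.2 (hτ hv ht hvt)) h2 (by linarith)
    have m3 : (τ t - τ u) ^ θ ≤ (τ t - τ s) ^ θ :=
      Real.rpow_le_rpow (sub_nonneg.2 (hτ hu ht (huv.trans hvt)))
        (by linarith [hτ hs hu hsu]) (by linarith)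
    have hhalf : ((τ t - τ s) / 2) ^ θ * 2 = 2 ^ (1 - θ) * (τ t - τ s) ^ θ := by
      rw [Real.div_rpow hw (by norm_num), Real.rpow_sub (by norm_num), Real.rpow_one]
      field_simp
    have hJ : J s t = J s u + J v t + ((J s t - J s u - J u t) + (J u t - J u v - J v t)) := by
      rw [h3]; abel
    calc ‖J s t‖ ≤ ‖J s u‖ + ‖J v t‖ +
          (‖J s t - J s u - J u t‖ + ‖J u t - J u v - J v t‖) := by
          conv_lhs => rw [hJ]
          exact (norm_add_le _ _).trans (add_le_add (norm_add_le _ _) (norm_add_le _ _))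
      _ ≤ N * ((τ t - τ s) / 2) ^ θ + N * ((τ t - τ s) / 2) ^ θ +
          (K * (τ t - τ s) ^ θ + K * (τ t - τ s) ^ θ) := by
          gcongr
          · exact e3.trans (by gcongr)
          · exact e4.trans (by gcongr)
          · exact e2.trans (by gcongr)
      _ = (2 ^ (1 - θ) * N + 2 * K) * (τ t - τ s) ^ θ := by
          linear_combination N * hhalf

/-- Euler scheme along a finite set of times. -/
lemma exists_euler {X : Type*} (A : ℝ → ℝ → X → X) (s₀ : ℝ) (x₀ : X) (D : Finset ℝ)
    (hD : ∀ t ∈ D, s₀ < t) :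
    ∃ y : ℝ → X, y s₀ = x₀ ∧ ∀ s ∈ insert s₀ D, ∀ t ∈ insert s₀ D, s < t →
      (∀ u ∈ insert s₀ D, u ≤ s ∨ t ≤ u) → y t = A s t (y s) := by
  induction D using Finset.induction_on_max with
  | empty =>
    refine ⟨fun _ => x₀, rfl, ?_⟩
    intro s hs t ht hst
    simp only [insert_empty_eq, Finset.mem_singleton] at hs ht
    subst hs ht
    exact absurd hst (lt_irrefl _)
  | insert m D hm ih =>
    obtain ⟨y, hy0, hy⟩ := ih (fun t ht => hD t (Finset.mem_insert_of_mem ht))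
    have hsm : s₀ < m := hD m (Finset.mem_insert_self _ _)
    have hne : (insert s₀ D).Nonempty := ⟨s₀, Finset.mem_insert_self _ _⟩
    have hlt : ∀ u ∈ insert s₀ D, u < m := by
      intro u hu
      rcases Finset.mem_insert.1 hu with rfl | hu
      · exact hsm
      · exact hm u hu
    set l := (insert s₀ D).max' hne with hl
    have hlm : l ∈ insert s₀ D := Finset.max'_mem _ _
    refine ⟨Function.update y m (A l m (y l)), ?_, ?_⟩
    · rw [Function.update_of_ne hsm.ne, hy0]
    · intro s hs t ht hst hcons
      rw [Finset.insert_comm] at hs ht hcons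
      have hs' : s ∈ insert s₀ D := by
        rcases Finset.mem_insert.1 hs with rfl | hs
        · rcases Finset.mem_insert.1 ht with rfl | ht
          · exact absurd hst (lt_irrefl _)
          · exact absurd (hlt t ht) (not_lt.2 hst.le)
        · exact hs
      rw [Function.update_of_ne (hlt s hs').ne]
      rcases Finset.mem_insert.1 ht with rfl | ht
      · have : s = l := by
          apply le_antisymm (Finset.le_max' _ _ hs')
          rcases hcons l (Finset.mem_insert_of_mem hlm) with h | h
          · exact h
          · exact absurd (hlt l hlm) (not_lt.2 h)
        rw [Function.update_self, this]
      · rw [Function.update_of_ne (hlt t ht).ne]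
        exact hy s hs' t ht hst (fun u hu => hcons u (Finset.mem_insert_of_mem hu))

/-- A transitive relation holding between consecutive points holds between all points. -/
lemma rel_of_consecutive {D : Finset ℝ} {R : ℝ → ℝ → Prop} (hrefl : ∀ s, R s s)
    (htrans : ∀ s ∈ D, ∀ u ∈ D, ∀ t ∈ D, s ≤ u → u ≤ t → R s u → R u t → R s t)
    (hcons : ∀ s ∈ D, ∀ t ∈ D, s < t → (∀ u ∈ D, u ≤ s ∨ t ≤ u) → R s t) :
    ∀ s ∈ D, ∀ t ∈ D, s ≤ t → R s t := by
  classical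
  intro s hs
  by_contra! hbad
  obtain ⟨t₁, ht₁, hst₁, hR₁⟩ := hbad
  have hne : (D.filter (fun t => s ≤ t ∧ ¬ R s t)).Nonempty :=
    ⟨t₁, Finset.mem_filter.2 ⟨ht₁, hst₁, hR₁⟩⟩
  set t := (D.filter (fun t => s ≤ t ∧ ¬ R s t)).min' hne with htdef
  obtain ⟨ht, hst, hR⟩ := Finset.mem_filter.1 (Finset.min'_mem _ hne)
  rw [← htdef] at ht hst hR
  have hst' : s < t := lt_of_le_of_ne hst (by rintro h; exact hR (h ▸ hrefl s))
  have hmem : s ∈ D.filter (fun u => u < t) := Finset.mem_filter.2 ⟨hs, hst'⟩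
  have hne2 : (D.filter (fun u => u < t)).Nonempty := ⟨s, hmem⟩
  set u := (D.filter (fun u => u < t)).max' hne2 with hudef
  obtain ⟨hu, hut⟩ := Finset.mem_filter.1 (Finset.max'_mem _ hne2)
  rw [← hudef] at hu hut
  have hsu : s ≤ u := Finset.le_max' _ _ hmem
  have hRu : R s u := by
    by_contra hRu
    have hmem' : u ∈ D.filter (fun t => s ≤ t ∧ ¬ R s t) := Finset.mem_filter.2 ⟨hu, hsu, hRu⟩
    exact absurd hut (not_lt.2 (Finset.min'_le _ _ hmem'))
  refine hR (htrans s hs u hu t ht hsu hut.le hRu (hcons u hu t ht hut ?_))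
  intro v hv
  by_cases hvt : v < t
  · have hmem' : v ∈ D.filter (fun u => u < t) := Finset.mem_filter.2 ⟨hv, hvt⟩
    exact Or.inl (Finset.le_max' _ _ hmem')
  · exact Or.inr (not_lt.1 hvt)

lemma exists_bound_of_finset {F : Type*} [NormedAddCommGroup F] (D : Finset ℝ) {τ : ℝ → ℝ}
    (hτ : StrictMonoOn τ (D : Set ℝ)) (J : ℝ → ℝ → F) (hJ : ∀ s, J s s = 0) (e : ℝ) :
    ∃ N₀, 0 ≤ N₀ ∧ ∀ s ∈ D, ∀ t ∈ D, s ≤ t → ‖J s t‖ ≤ N₀ * (τ t - τ s) ^ e := by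
  refine ⟨∑ z ∈ D ×ˢ D, ‖J z.1 z.2‖ / |τ z.2 - τ z.1| ^ e,
    Finset.sum_nonneg fun z _ => by positivity, ?_⟩
  intro s hs t ht hst
  rcases hst.eq_or_lt with rfl | hst
  · rw [hJ, norm_zero]
    exact mul_nonneg (Finset.sum_nonneg fun z _ => by positivity)
      (Real.rpow_nonneg (by simp) _)
  have hpos : 0 < τ t - τ s := sub_pos.2 (hτ hs ht hst)
  have h1 : ‖J s t‖ / |τ t - τ s| ^ e ≤ ∑ z ∈ D ×ˢ D, ‖J z.1 z.2‖ / |τ z.2 - τ z.1| ^ e :=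
    Finset.single_le_sum (f := fun z : ℝ × ℝ => ‖J z.1 z.2‖ / |τ z.2 - τ z.1| ^ e)
      (fun z _ => by positivity) (Finset.mk_mem_product hs ht)
  rw [abs_of_pos hpos] at h1
  rwa [div_le_iff₀ (by positivity)] at h1

lemma exists_split_of_finset (D : Finset ℝ) {τ : ℝ → ℝ} (hτ : MonotoneOn τ (D : Set ℝ))
    {s t : ℝ} (hs : s ∈ D) (ht : t ∈ D) (hst : s < t) :
    ∃ u ∈ D, ∃ v ∈ D, s ≤ u ∧ u ≤ v ∧ v ≤ t ∧ τ u - τ s ≤ (τ t - τ s) / 2 ∧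
      τ t - τ v ≤ (τ t - τ s) / 2 ∧ (u = v ∨ (u < v ∧ ∀ r ∈ D, r ≤ u ∨ v ≤ r)) := by
  have hw : 0 ≤ τ t - τ s := sub_nonneg.2 (hτ hs ht hst.le)
  have hmem : s ∈ D.filter (fun u => u ≤ t ∧ τ u - τ s ≤ (τ t - τ s) / 2) :=
    Finset.mem_filter.2 ⟨hs, hst.le, by linarith⟩
  set u := (D.filter (fun u => u ≤ t ∧ τ u - τ s ≤ (τ t - τ s) / 2)).max' ⟨s, hmem⟩ with hudef
  obtain ⟨hu, hut, hu2⟩ := Finset.mem_filter.1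
    (Finset.max'_mem (D.filter (fun u => u ≤ t ∧ τ u - τ s ≤ (τ t - τ s) / 2)) ⟨s, hmem⟩)
  rw [← hudef] at hu hut hu2
  have hsu : s ≤ u := Finset.le_max' _ _ hmem
  rcases hut.eq_or_lt with hut | hut
  · exact ⟨u, hu, u, hu, hsu, le_rfl, hut.le, hu2, by rw [hut]; linarith, Or.inl rfl⟩
  have hmem2 : t ∈ D.filter (fun v => u < v) := Finset.mem_filter.2 ⟨ht, hut⟩
  set v := (D.filter (fun v => u < v)).min' ⟨t, hmem2⟩ with hvdef
  obtain ⟨hv, huv⟩ := Finset.mem_filter.1 (Finset.min'_mem (D.filter (fun v => u < v)) ⟨t, hmem2⟩)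
  rw [← hvdef] at hv huv
  have hvt : v ≤ t := Finset.min'_le _ _ hmem2
  refine ⟨u, hu, v, hv, hsu, huv.le, hvt, hu2, ?_, Or.inr ⟨huv, fun r hr => ?_⟩⟩
  · by_contra! hlt
    have : v ∈ D.filter (fun u => u ≤ t ∧ τ u - τ s ≤ (τ t - τ s) / 2) :=
      Finset.mem_filter.2 ⟨hv, hvt, by linarith⟩
    exact absurd huv (not_lt.2 (Finset.le_max' _ _ this))
  · by_cases hru : u < r
    · exact Or.inr (Finset.min'_le _ _ (Finset.mem_filter.2 ⟨hr, hru⟩))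
    · exact Or.inl (not_lt.1 hru)

/-- Standing assumptions for a rough equation `dy = g(s,y) dω + drift`, where all increments are
measured by the clock `τ`: the driver `ω` is `κ`-Hölder, `g` is `γ`-Hölder in time and Lipschitz
in space, and `Φ s t x` is the drift accumulated over `[s,t]` at the frozen position `x`. -/
structure RoughData {E F : Type*} [NormedAddCommGroup E] [NormedSpace ℝ E]
    [NormedAddCommGroup F] [NormedSpace ℝ F] (A B κ γ : ℝ) (τ : ℝ → ℝ) (ω : ℝ → E)
    (g : ℝ → F → E →L[ℝ] F) (Φ : ℝ → ℝ → F → F) (H L G : ℝ) (Λ : ℝ → ℝ) : Prop where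
  κ_lt : κ < 1
  γ_pos : 0 < γ
  γ_lt : γ < κ
  one_lt : 1 < γ + κ
  H_nonneg : 0 ≤ H
  L_nonneg : 0 ≤ L
  G_nonneg : 0 ≤ G
  τ_cont : ContinuousOn τ (Icc A B)
  τ_mono : StrictMonoOn τ (Icc A B)
  ω_le : ∀ s ∈ Icc A B, ∀ t ∈ Icc A B, s ≤ t → ‖ω t - ω s‖ ≤ (τ t - τ s) ^ κ
  g_le : ∀ s ∈ Icc A B, ∀ t ∈ Icc A B, s ≤ t → ∀ x y,
    ‖g t x - g s y‖ ≤ H * (τ t - τ s) ^ γ + L * ‖x - y‖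
  g_growth : ∀ s ∈ Icc A B, ∀ x, ‖g s x‖ ≤ G + L * ‖x‖
  drift_add : ∀ s ∈ Icc A B, ∀ u ∈ Icc A B, ∀ t ∈ Icc A B, s ≤ u → u ≤ t → ∀ x,
    Φ s u x + Φ u t x = Φ s t x
  drift_growth : ∀ s ∈ Icc A B, ∀ t ∈ Icc A B, s ≤ t → ∀ x,
    ‖Φ s t x‖ ≤ (‖x‖ + 1) * (τ t - τ s)
  Λ_nonneg : ∀ R, 0 ≤ R → 0 ≤ Λ R
  drift_lip : ∀ R, 0 ≤ R → ∀ s ∈ Icc A B, ∀ t ∈ Icc A B, s ≤ t → ∀ x y, ‖x‖ ≤ R → ‖y‖ ≤ R →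
    ‖Φ s t x - Φ s t y‖ ≤ Λ R * ‖x - y‖ * (τ t - τ s)

/-- `y` satisfies on `S` the one-step expansion characterizing solutions, with constant `C`. -/
def IsDavieOn {E F : Type*} [NormedAddCommGroup E] [NormedSpace ℝ E]
    [NormedAddCommGroup F] [NormedSpace ℝ F] (κ γ : ℝ) (τ : ℝ → ℝ) (ω : ℝ → E)
    (g : ℝ → F → E →L[ℝ] F) (Φ : ℝ → ℝ → F → F) (S : Set ℝ) (C : ℝ) (y : ℝ → F) : Prop :=
  ∀ s ∈ S, ∀ t ∈ S, s ≤ t → ‖y t - y s‖ ≤ C * (τ t - τ s) ^ κ ∧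
    ‖y t - y s - g s (y s) (ω t - ω s) - Φ s t (y s)‖ ≤ C * (τ t - τ s) ^ (γ + κ)

namespace RoughData

variable {E F : Type*} [NormedAddCommGroup E] [NormedSpace ℝ E]
  [NormedAddCommGroup F] [NormedSpace ℝ F] {A B κ γ : ℝ} {τ : ℝ → ℝ} {ω : ℝ → E}
  {g : ℝ → F → E →L[ℝ] F} {Φ : ℝ → ℝ → F → F} {H L G : ℝ} {Λ : ℝ → ℝ}

lemma τ_sub_nonneg (h : RoughData A B κ γ τ ω g Φ H L G Λ) {s t : ℝ} (hs : s ∈ Icc A B)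
    (ht : t ∈ Icc A B) (hst : s ≤ t) : 0 ≤ τ t - τ s :=
  sub_nonneg.2 (h.τ_mono.monotoneOn hs ht hst)

lemma drift_self (h : RoughData A B κ γ τ ω g Φ H L G Λ) {s : ℝ} (hs : s ∈ Icc A B) (x : F) :
    Φ s s x = 0 := by
  have := h.drift_add s hs s hs s hs le_rfl le_rfl x
  simpa using this

lemma κ_pos (h : RoughData A B κ γ τ ω g Φ H L G Λ) : 0 < κ := h.γ_pos.trans h.γ_lt

lemma defect_le (h : RoughData A B κ γ τ ω g Φ H L G Λ) {s u t N : ℝ} (hN : 0 ≤ N)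
    (hs : s ∈ Icc A B) (hu : u ∈ Icc A B) (ht : t ∈ Icc A B) (hsu : s ≤ u) (hut : u ≤ t)
    {x y : F} (hxy : ‖x - y‖ ≤ N * (τ u - τ s) ^ γ) :
    ‖(g u x - g s y) (ω t - ω u)‖ ≤ (H + L * N) * (τ t - τ s) ^ (γ + κ) := by
  have h1 := h.τ_sub_nonneg hs hu hsu
  have h2 := h.τ_sub_nonneg hu ht hut
  have h3 := h.τ_sub_nonneg hs ht (hsu.trans hut)
  have hH := h.H_nonneg
  have hL := h.L_nonneg
  calc ‖(g u x - g s y) (ω t - ω u)‖ ≤ ‖g u x - g s y‖ * ‖ω t - ω u‖ :=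
        ContinuousLinearMap.le_opNorm _ _
    _ ≤ (H * (τ u - τ s) ^ γ + L * (N * (τ u - τ s) ^ γ)) * (τ t - τ u) ^ κ := by
        gcongr
        · exact (h.g_le s hs u hu hsu x y).trans (by gcongr)
        · exact h.ω_le u hu t ht hut
    _ = (H + L * N) * ((τ u - τ s) ^ γ * (τ t - τ u) ^ κ) := by ring
    _ ≤ (H + L * N) * ((τ t - τ s) ^ γ * (τ t - τ s) ^ κ) := by
        have e1 : (τ u - τ s) ^ γ ≤ (τ t - τ s) ^ γ :=
          Real.rpow_le_rpow h1 (by linarith) h.γ_pos.le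
        have e2 : (τ t - τ u) ^ κ ≤ (τ t - τ s) ^ κ :=
          Real.rpow_le_rpow h2 (by linarith) h.κ_pos.le
        gcongr
    _ = (H + L * N) * (τ t - τ s) ^ (γ + κ) := by
        rw [Real.rpow_add_of_nonneg h3 h.γ_pos.le h.κ_pos.le]

/-- Uniform estimates for Euler schemes on short intervals. -/
lemma exists_discrete (h : RoughData A B κ γ τ ω g Φ H L G Λ) :
    ∃ η, 0 < η ∧ ∀ x₀ : F, ∃ R C, 0 ≤ R ∧ 0 ≤ C ∧ ∀ s₀ ∈ Icc A B, ∀ s₁ ∈ Icc A B, s₀ ≤ s₁ →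
      τ s₁ - τ s₀ ≤ η → ∀ D : Finset ℝ, (∀ t ∈ D, s₀ < t ∧ t ≤ s₁) →
      ∃ y : ℝ → F, y s₀ = x₀ ∧ (∀ t ∈ insert s₀ D, ‖y t‖ ≤ R) ∧
        IsDavieOn κ γ τ ω g Φ (insert s₀ D : Finset ℝ) C y := by
  have hH := h.H_nonneg
  have hL := h.L_nonneg
  have hG := h.G_nonneg
  have hθ := h.one_lt
  have hγ := h.γ_pos
  have hκ := h.κ_pos
  have hsC := sewC_pos hθ
  have hsC' := hsC.le
  set c := sewC (γ + κ) with hc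
  set C₁ := c * L + L + 1 with hC₁
  have hC₁1 : 1 ≤ C₁ := by rw [hC₁]; nlinarith
  set η := (1 / (2 * C₁)) ^ (1 / (κ - γ)) with hη
  have hκγ : 0 < κ - γ := sub_pos.2 h.γ_lt
  have hη0 : 0 < η := by positivity
  have hη1 : η ≤ 1 := Real.rpow_le_one (by positivity)
    (by rw [div_le_one (by positivity)]; linarith) (by positivity)
  have hηC : C₁ * η ^ (κ - γ) = 1 / 2 := by
    rw [hη, ← Real.rpow_mul (by positivity), one_div_mul_cancel hκγ.ne', Real.rpow_one]
    field_simp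
  have hηle : η ^ (κ - γ) ≤ 1 := Real.rpow_le_one hη0.le hη1 hκγ.le
  refine ⟨η, hη0, fun x₀ => ?_⟩
  set K₀ := c * H + G + (L + 1) * ‖x₀‖ + 1 with hK₀
  have hK₀0 : 0 ≤ K₀ := by positivity
  set N₁ := 2 * K₀ with hN₁
  set R := ‖x₀‖ + N₁ with hR
  have hR0 : 0 ≤ R := by positivity
  have hΛ := h.Λ_nonneg R hR0
  set Cκ := C₁ * N₁ + K₀ with hCκ
  set CJ := c * (H + L * N₁) + c * (Λ R * N₁) with hCJ
  have hCκ0 : 0 ≤ Cκ := by positivity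
  have hCJ0 : 0 ≤ CJ := by positivity
  refine ⟨R, Cκ + CJ, hR0, by positivity, fun s₀ hs₀ s₁ hs₁ hs₀₁ hτη D hD => ?_⟩
  obtain ⟨z, hz0, hz⟩ := exists_euler (X := F × F)
    (fun s t w => (w.1 + g s w.1 (ω t - ω s) + Φ s t w.1, w.2 + Φ s t w.1)) s₀ (x₀, 0) D
    (fun t ht => (hD t ht).1)
  set D' := insert s₀ D with hD'
  have hD's : ∀ t ∈ D', s₀ ≤ t ∧ t ≤ s₁ := by
    intro t ht
    rcases Finset.mem_insert.1 ht with rfl | ht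
    · exact ⟨le_rfl, hs₀₁⟩
    · exact ⟨(hD t ht).1.le, (hD t ht).2⟩
  have hs₀D : s₀ ∈ D' := Finset.mem_insert_self _ _
  have hmem : ∀ t ∈ D', t ∈ Icc A B := fun t ht =>
    ⟨hs₀.1.trans (hD's t ht).1, (hD's t ht).2.trans hs₁.2⟩
  have hτD : StrictMonoOn τ (D' : Set ℝ) := h.τ_mono.mono (fun t ht => hmem t ht)
  have hτ0 : ∀ s ∈ D', ∀ t ∈ D', s ≤ t → 0 ≤ τ t - τ s := fun s hs t ht hst =>
    h.τ_sub_nonneg (hmem s hs) (hmem t ht) hst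
  have hτ1 : ∀ s ∈ D', ∀ t ∈ D', s ≤ t → τ t - τ s ≤ η := fun s hs t ht hst => by
    have e1 := h.τ_mono.monotoneOn hs₀ (hmem s hs) (hD's s hs).1
    have e2 := h.τ_mono.monotoneOn (hmem t ht) hs₁ (hD's t ht).2
    linarith
  set y : ℝ → F := fun t => (z t).1 with hy
  set W : ℝ → F := fun t => (z t).2 with hW
  have hyE : ∀ s ∈ D', ∀ t ∈ D', s < t → (∀ u ∈ D', u ≤ s ∨ t ≤ u) →
      y t = y s + g s (y s) (ω t - ω s) + Φ s t (y s) := by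
    intro s hs t ht hst hcons
    simp only [hy, hz s hs t ht hst hcons]
  have hWE : ∀ s ∈ D', ∀ t ∈ D', s < t → (∀ u ∈ D', u ≤ s ∨ t ≤ u) →
      W t = W s + Φ s t (y s) := by
    intro s hs t ht hst hcons
    simp only [hW, hy, hz s hs t ht hst hcons]
  have hy0 : y s₀ = x₀ := by simp [hy, hz0]
  -- consequences of a `γ`-Hölder bound on `y`
  have hbd : ∀ N, 0 ≤ N →
      (∀ s ∈ D', ∀ t ∈ D', s ≤ t → ‖y t - y s‖ ≤ N * (τ t - τ s) ^ γ) →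
      ∀ t ∈ D', ‖y t‖ ≤ ‖x₀‖ + N := by
    intro N hN hP t ht
    have e := hP s₀ hs₀D t ht (hD's t ht).1
    have e2 : (τ t - τ s₀) ^ γ ≤ 1 := Real.rpow_le_one (hτ0 _ hs₀D t ht (hD's t ht).1)
      ((hτ1 _ hs₀D t ht (hD's t ht).1).trans hη1) hγ.le
    rw [hy0] at e
    have e3 : y t = x₀ + (y t - x₀) := by abel
    rw [e3]
    exact (norm_add_le _ _).trans (by nlinarith)
  have hWbd : ∀ M, (∀ t ∈ D', ‖y t‖ ≤ M) →
      ∀ s ∈ D', ∀ t ∈ D', s ≤ t → ‖W t - W s‖ ≤ (M + 1) * (τ t - τ s) := by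
    intro M hM
    refine rel_of_consecutive (R := fun s t => ‖W t - W s‖ ≤ (M + 1) * (τ t - τ s))
      (by simp) ?_ ?_
    · intro s _ u _ t _ _ _ e1 e2
      have : W t - W s = (W u - W s) + (W t - W u) := by abel
      rw [this]
      exact (norm_add_le _ _).trans (by linarith)
    · intro s hs t ht hst hcons
      rw [hWE s hs t ht hst hcons, add_sub_cancel_left]
      refine (h.drift_growth s (hmem s hs) t (hmem t ht) hst.le _).trans ?_
      have := hτ0 s hs t ht hst.le
      gcongr
      exact hM s hs
  set J : ℝ → ℝ → F := fun s t => y t - y s - g s (y s) (ω t - ω s) - (W t - W s) with hJ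
  have hJ0 : ∀ s, J s s = 0 := by intro s; simp [hJ]
  have hsplit : ∀ Q : ℝ → ℝ → F, (∀ s ∈ D', Q s s = 0) →
      (∀ s ∈ D', ∀ t ∈ D', s < t → (∀ u ∈ D', u ≤ s ∨ t ≤ u) → Q s t = 0) →
      ∀ s ∈ (D' : Set ℝ), ∀ t ∈ (D' : Set ℝ), s < t →
      ∃ u ∈ (D' : Set ℝ), ∃ v ∈ (D' : Set ℝ), s ≤ u ∧ u ≤ v ∧ v ≤ t ∧
      τ u - τ s ≤ (τ t - τ s) / 2 ∧ τ t - τ v ≤ (τ t - τ s) / 2 ∧ Q u v = 0 := by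
    intro Q hQ0 hQ s hs t ht hst
    obtain ⟨u, hu, v, hv, h1, h2, h3, h4, h5, h6⟩ :=
      exists_split_of_finset D' hτD.monotoneOn hs ht hst
    refine ⟨u, hu, v, hv, h1, h2, h3, h4, h5, ?_⟩
    rcases h6 with rfl | ⟨h6, h7⟩
    · exact hQ0 u hu
    · exact hQ u hu v hv h6 h7
  have hJbd : ∀ N, 0 ≤ N →
      (∀ s ∈ D', ∀ t ∈ D', s ≤ t → ‖y t - y s‖ ≤ N * (τ t - τ s) ^ γ) →
      ∀ s ∈ D', ∀ t ∈ D', s ≤ t → ‖J s t‖ ≤ c * (H + L * N) * (τ t - τ s) ^ (γ + κ) := by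
    intro N hN hP
    obtain ⟨N₀, hN₀, hN₀b⟩ := exists_bound_of_finset D' hτD J hJ0 (γ + κ)
    refine sewing_bound hθ (by positivity) hN₀ hτD.monotoneOn
      (hsplit J (fun s _ => hJ0 s) ?_) ?_ hN₀b
    · intro s hs t ht hst hcons
      simp only [hJ]
      rw [hyE s hs t ht hst hcons, hWE s hs t ht hst hcons]
      abel
    · intro s hs u hu t ht hsu hut
      have e : J s t - J s u - J u t = (g u (y u) - g s (y s)) (ω t - ω u) := by
        have e1 : ω t - ω s = (ω t - ω u) + (ω u - ω s) := by abel
        simp only [hJ, e1, map_add, sub_apply]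
        abel
      rw [e]
      exact h.defect_le hN (hmem s hs) (hmem u hu) (hmem t ht) hsu hut (hP s hs u hu hsu)
  have hκbd : ∀ N, 0 ≤ N →
      (∀ s ∈ D', ∀ t ∈ D', s ≤ t → ‖y t - y s‖ ≤ N * (τ t - τ s) ^ γ) →
      ∀ s ∈ D', ∀ t ∈ D', s ≤ t → ‖y t - y s‖ ≤ (C₁ * N + K₀) * (τ t - τ s) ^ κ := by
    intro N hN hP s hs t ht hst
    have hw0 := hτ0 s hs t ht hst
    have hw1 := (hτ1 s hs t ht hst).trans hη1
    have b1 := hJbd N hN hP s hs t ht hst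
    have b2 := hWbd _ (hbd N hN hP) s hs t ht hst
    have b3 : ‖g s (y s) (ω t - ω s)‖ ≤ (G + L * (‖x₀‖ + N)) * (τ t - τ s) ^ κ := by
      refine (ContinuousLinearMap.le_opNorm _ _).trans ?_
      gcongr
      · exact (h.g_growth s (hmem s hs) _).trans (by gcongr; exact hbd N hN hP s hs)
      · exact h.ω_le s (hmem s hs) t (hmem t ht) hst
    have p1 : (τ t - τ s) ^ (γ + κ) ≤ (τ t - τ s) ^ κ := by
      simpa using rpow_le_mul_rpow hw0 hw1 (show κ ≤ γ + κ by linarith) hκ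
    have p2 : (τ t - τ s) ≤ (τ t - τ s) ^ κ := by
      simpa using rpow_le_mul_rpow hw0 hw1 h.κ_lt.le hκ
    have e : y t - y s = J s t + g s (y s) (ω t - ω s) + (W t - W s) := by
      simp only [hJ]; abel
    calc ‖y t - y s‖ ≤ ‖J s t‖ + ‖g s (y s) (ω t - ω s)‖ + ‖W t - W s‖ := by
          rw [e]; exact norm_add₃_le
      _ ≤ c * (H + L * N) * (τ t - τ s) ^ κ + (G + L * (‖x₀‖ + N)) * (τ t - τ s) ^ κ +
          (‖x₀‖ + N + 1) * (τ t - τ s) ^ κ := by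
          gcongr
          · exact b1.trans (by gcongr)
          · exact b2.trans (by gcongr)
      _ = (C₁ * N + K₀) * (τ t - τ s) ^ κ := by rw [hC₁, hK₀]; ring
  have hγ1 : ∀ s ∈ D', ∀ t ∈ D', s ≤ t → ‖y t - y s‖ ≤ N₁ * (τ t - τ s) ^ γ := by
    obtain ⟨N₀, hN₀, hN₀b⟩ := exists_bound_of_finset D' hτD (fun s t => y t - y s) (by simp) γ
    intro s₂ hs₂ t₂ ht₂ hst₂
    have := le_of_contract (c := 1 / 2) (K := K₀) (N₀ := N₀) (X := ‖y t₂ - y s₂‖)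
      (Y := (τ t₂ - τ s₂) ^ γ)
      (P := fun N => ∀ s ∈ D', ∀ t ∈ D', s ≤ t → ‖y t - y s‖ ≤ N * (τ t - τ s) ^ γ)
      (by norm_num) (by norm_num) hK₀0 hN₀ hN₀b ?_ (fun N hN => hN s₂ hs₂ t₂ ht₂ hst₂)
    · refine this.trans_eq ?_
      rw [hN₁]; ring
    · intro N hN hP s hs t ht hst
      refine (hκbd N hN hP s hs t ht hst).trans ?_
      have hw0 := hτ0 s hs t ht hst
      have e := rpow_le_mul_rpow hw0 (hτ1 s hs t ht hst) h.γ_lt.le hγ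
      calc (C₁ * N + K₀) * (τ t - τ s) ^ κ
          ≤ (C₁ * N + K₀) * (η ^ (κ - γ) * (τ t - τ s) ^ γ) := by gcongr
        _ = (C₁ * η ^ (κ - γ) * N + K₀ * η ^ (κ - γ)) * (τ t - τ s) ^ γ := by ring
        _ ≤ (1 / 2 * N + K₀ * 1) * (τ t - τ s) ^ γ := by rw [hηC]; gcongr
        _ = (1 / 2 * N + K₀) * (τ t - τ s) ^ γ := by ring
  have hN₁0 : 0 ≤ N₁ := by positivity
  have hyR := hbd N₁ hN₁0 hγ1
  have hDr : ∀ s ∈ D', ∀ t ∈ D', s ≤ t →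
      ‖W t - W s - Φ s t (y s)‖ ≤ c * (Λ R * N₁) * (τ t - τ s) ^ (γ + κ) := by
    set Q : ℝ → ℝ → F := fun s t => if s = t then 0 else W t - W s - Φ s t (y s) with hQ
    have hQe : ∀ s ∈ D', ∀ t ∈ D', Q s t = W t - W s - Φ s t (y s) := by
      intro s hs t _
      by_cases hst : s = t
      · subst hst
        simp [hQ, h.drift_self (hmem s hs)]
      · simp [hQ, hst]
    obtain ⟨N₀, hN₀, hN₀b⟩ := exists_bound_of_finset D' hτD Q (by simp [hQ]) (γ + κ)
    have := sewing_bound hθ (J := Q) (K := Λ R * N₁) (by positivity) hN₀ hτD.monotoneOn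
      (hsplit Q (fun s _ => by simp [hQ]) ?_) ?_ hN₀b
    · intro s hs t ht hst
      rw [← hQe s hs t ht]
      exact this s hs t ht hst
    · intro s hs t ht hst hcons
      rw [hQe s hs t ht, hWE s hs t ht hst hcons]
      abel
    · intro s hs u hu t ht hsu hut
      have e : Q s t - Q s u - Q u t = Φ u t (y u) - Φ u t (y s) := by
        rw [hQe s hs t ht, hQe s hs u hu, hQe u hu t ht,
          ← h.drift_add s (hmem s hs) u (hmem u hu) t (hmem t ht) hsu hut]
        abel
      have w1 := hτ0 s hs u hu hsu
      have w2 := hτ0 u hu t ht hut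
      have w3 := hτ0 s hs t ht (hsu.trans hut)
      have w4 := (hτ1 s hs t ht (hsu.trans hut)).trans hη1
      rw [e]
      calc ‖Φ u t (y u) - Φ u t (y s)‖ ≤ Λ R * ‖y u - y s‖ * (τ t - τ u) :=
            h.drift_lip R hR0 u (hmem u hu) t (hmem t ht) hut _ _ (hyR u hu) (hyR s hs)
        _ ≤ Λ R * (N₁ * (τ t - τ s) ^ γ) * (τ t - τ s) ^ κ := by
            gcongr
            · refine (hγ1 s hs u hu hsu).trans ?_
              gcongr
              linarith
            · calc τ t - τ u ≤ τ t - τ s := by linarith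
                _ ≤ (τ t - τ s) ^ κ := by
                  simpa using rpow_le_mul_rpow w3 w4 h.κ_lt.le hκ
        _ = Λ R * N₁ * (τ t - τ s) ^ (γ + κ) := by
            rw [Real.rpow_add_of_nonneg w3 hγ.le hκ.le]; ring
  refine ⟨y, hy0, hyR, fun s hs t ht hst => ⟨?_, ?_⟩⟩
  · have hw0 := hτ0 s hs t ht hst
    exact (hκbd N₁ hN₁0 hγ1 s hs t ht hst).trans
      (mul_le_mul_of_nonneg_right (by linarith) (by positivity))
  · have hw0 := hτ0 s hs t ht hst
    have e : y t - y s - g s (y s) (ω t - ω s) - Φ s t (y s) =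
        J s t + (W t - W s - Φ s t (y s)) := by simp only [hJ]; abel
    rw [e]
    refine (norm_add_le _ _).trans ((add_le_add (hJbd N₁ hN₁0 hγ1 s hs t ht hst)
      (hDr s hs t ht hst)).trans ?_)
    rw [← add_mul, ← hCJ]
    gcongr
    linarith

end RoughData

namespace RoughData

variable {E F : Type*} [NormedAddCommGroup E] [NormedSpace ℝ E]
  [NormedAddCommGroup F] [NormedSpace ℝ F] {A B κ γ : ℝ} {τ : ℝ → ℝ} {ω : ℝ → E}
  {g : ℝ → F → E →L[ℝ] F} {Φ : ℝ → ℝ → F → F} {H L G : ℝ} {Λ : ℝ → ℝ}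

/-- Local existence on intervals that are short for the clock, uniformly in the initial value. -/
lemma exists_local [ProperSpace F] (h : RoughData A B κ γ τ ω g Φ H L G Λ) :
    ∃ η, 0 < η ∧ ∀ x₀ : F, ∀ s₀ ∈ Icc A B, ∀ s₁ ∈ Icc A B, s₀ ≤ s₁ →
      τ s₁ - τ s₀ ≤ η → ∃ y : ℝ → F, ∃ C, 0 ≤ C ∧ y s₀ = x₀ ∧
        IsDavieOn κ γ τ ω g Φ (Icc s₀ s₁) C y := by
  classical
  obtain ⟨η, hη, hE⟩ := h.exists_discrete
  refine ⟨η, hη, fun x₀ s₀ hs₀ s₁ hs₁ hs hτ => ?_⟩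
  obtain ⟨R, C, hR, hC, hE⟩ := hE x₀
  have hE' := fun D : Finset ℝ => hE s₀ hs₀ s₁ hs₁ hs hτ (D.filter (fun t => s₀ < t ∧ t ≤ s₁))
    (fun t ht => (Finset.mem_filter.1 ht).2)
  choose y hy0 hyR hy using hE'
  set D' : Finset ℝ → Finset ℝ := fun D => insert s₀ (D.filter (fun t => s₀ < t ∧ t ≤ s₁))
    with hD'
  set Y : Finset ℝ → ℝ → F := fun D t => if t ∈ D' D then y D t else 0 with hY
  have hYR : ∀ D t, ‖Y D t‖ ≤ R := by
    intro D t
    by_cases ht : t ∈ D' D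
    · simpa [hY, ht] using hyR D t ht
    · simpa [hY, ht] using hR
  have hcomp : IsCompact (Set.pi univ (fun _ : ℝ => Metric.closedBall (0 : F) R)) :=
    isCompact_univ_pi fun _ => isCompact_closedBall _ _
  set U : Ultrafilter (Finset ℝ) := Ultrafilter.of Filter.atTop
  have hU : (U : Filter (Finset ℝ)) ≤ Filter.atTop := Ultrafilter.of_le _
  obtain ⟨z, -, hz⟩ := hcomp.ultrafilter_le_nhds (U.map Y) (by
    rw [Filter.le_principal_iff]
    exact Filter.mem_map.2 (Filter.univ_mem' fun D t _ => by simpa using hYR D t))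
  have hzt : ∀ t, Filter.Tendsto (fun D => Y D t) U (nhds (z t)) :=
    tendsto_pi_nhds.1 hz
  have hzR : ∀ t, ‖z t‖ ≤ R := fun t =>
    le_of_tendsto (hzt t).norm (Filter.Eventually.of_forall fun D => hYR D t)
  have hev : ∀ t ∈ Icc s₀ s₁, ∀ᶠ D in (U : Filter (Finset ℝ)), t ∈ D' D := by
    intro t ht
    refine hU ?_
    filter_upwards [Filter.eventually_ge_atTop ({t} : Finset ℝ)] with D hD
    have htD : t ∈ D := hD (Finset.mem_singleton_self t)
    rcases ht.1.eq_or_lt with h1 | h1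
    · exact h1 ▸ Finset.mem_insert_self _ _
    · exact Finset.mem_insert_of_mem (Finset.mem_filter.2 ⟨htD, h1, ht.2⟩)
  refine ⟨z, C, hC, ?_, ?_⟩
  · refine tendsto_nhds_unique (hzt s₀) (tendsto_const_nhds.congr fun D => ?_)
    simp [hY, hD', hy0]
  intro s hsI t htI hst
  have hsAB : s ∈ Icc A B := ⟨hs₀.1.trans hsI.1, hsI.2.trans hs₁.2⟩
  have htAB : t ∈ Icc A B := ⟨hs₀.1.trans htI.1, htI.2.trans hs₁.2⟩
  have hw := h.τ_sub_nonneg hsAB htAB hst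
  have hg : Filter.Tendsto (fun D => g s (Y D s)) U (nhds (g s (z s))) := by
    rw [tendsto_iff_norm_sub_tendsto_zero]
    refine squeeze_zero (fun _ => norm_nonneg _) (fun D => ?_)
      (by simpa using (tendsto_iff_norm_sub_tendsto_zero.1 (hzt s)).const_mul L)
    simpa [Real.zero_rpow h.γ_pos.ne'] using h.g_le s hsAB s hsAB le_rfl (Y D s) (z s)
  have hΦ : Filter.Tendsto (fun D => Φ s t (Y D s)) U (nhds (Φ s t (z s))) := by
    rw [tendsto_iff_norm_sub_tendsto_zero]
    refine squeeze_zero (fun _ => norm_nonneg _)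
      (fun D => h.drift_lip R hR s hsAB t htAB hst _ _ (hYR D s) (hzR s)) ?_
    simpa using ((tendsto_iff_norm_sub_tendsto_zero.1 (hzt s)).const_mul (Λ R)).mul_const
      (τ t - τ s)
  have hgω : Filter.Tendsto (fun D => g s (Y D s) (ω t - ω s)) U
      (nhds (g s (z s) (ω t - ω s))) :=
    ((ContinuousLinearMap.apply ℝ F (ω t - ω s)).continuous.tendsto _).comp hg
  constructor
  · refine le_of_tendsto ((hzt t).sub (hzt s)).norm ?_
    filter_upwards [hev s hsI, hev t htI] with D h1 h2
    simpa [hY, h1, h2] using (hy D s h1 t h2 hst).1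
  · refine le_of_tendsto ((((hzt t).sub (hzt s)).sub hgω).sub hΦ).norm ?_
    filter_upwards [hev s hsI, hev t htI] with D h1 h2
    simpa [hY, h1, h2] using (hy D s h1 t h2 hst).2

lemma norm_le_of_davie (h : RoughData A B κ γ τ ω g Φ H L G Λ) {a v C : ℝ} (hC : 0 ≤ C)
    (ha : a ∈ Icc A B) (hv : v ∈ Icc A B) {y : ℝ → F}
    (hy : IsDavieOn κ γ τ ω g Φ (Icc a v) C y) :
    ∀ t ∈ Icc a v, ‖y t‖ ≤ ‖y a‖ + C * (τ B - τ A) ^ κ := by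
  intro t ht
  have htI : t ∈ Icc A B := ⟨ha.1.trans ht.1, ht.2.trans hv.2⟩
  have hAB : A ≤ B := ha.1.trans ha.2
  have hA : A ∈ Icc A B := ⟨le_rfl, hAB⟩
  have hB : B ∈ Icc A B := ⟨hAB, le_rfl⟩
  have e1 := h.τ_mono.monotoneOn hA ha ha.1
  have e2 := h.τ_mono.monotoneOn htI hB htI.2
  have e3 := h.τ_sub_nonneg ha htI ht.1
  have e := (hy a ⟨le_rfl, ht.1.trans ht.2⟩ t ht ht.1).1
  have e4 : y t = y a + (y t - y a) := by abel
  rw [e4]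
  refine (norm_add_le _ _).trans ((add_le_add_iff_left _).2 (e.trans ?_))
  have := h.κ_pos
  gcongr

lemma glue (h : RoughData A B κ γ τ ω g Φ H L G Λ) {a u v C₁ C₂ : ℝ} (hC₁ : 0 ≤ C₁)
    (hC₂ : 0 ≤ C₂) (ha : A ≤ a) (hau : a ≤ u) (huv : u ≤ v) (hv : v ≤ B) {y : ℝ → F}
    (h₁ : IsDavieOn κ γ τ ω g Φ (Icc a u) C₁ y) (h₂ : IsDavieOn κ γ τ ω g Φ (Icc u v) C₂ y) :
    ∃ C, 0 ≤ C ∧ IsDavieOn κ γ τ ω g Φ (Icc a v) C y := by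
  have haI : a ∈ Icc A B := ⟨ha, hau.trans (huv.trans hv)⟩
  have huI : u ∈ Icc A B := ⟨ha.trans hau, huv.trans hv⟩
  have hAB : A ≤ B := haI.1.trans haI.2
  have hA : A ∈ Icc A B := ⟨le_rfl, hAB⟩
  have hB : B ∈ Icc A B := ⟨hAB, le_rfl⟩
  have hγ := h.γ_pos
  have hκ := h.κ_pos
  have hH := h.H_nonneg
  have hL := h.L_nonneg
  set M := τ B - τ A with hM
  have hM0 : 0 ≤ M := h.τ_sub_nonneg hA hB hAB
  set R := ‖y a‖ + C₁ * M ^ κ with hR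
  have hR0 : 0 ≤ R := by positivity
  have hΛ := h.Λ_nonneg R hR0
  have hyR := h.norm_le_of_davie hC₁ haI huI h₁
  set K₁ := H + L * (C₁ * M ^ (κ - γ)) with hK₁
  set K₂ := Λ R * C₁ * M ^ (1 - γ) with hK₂
  have hK₁0 : 0 ≤ K₁ := by positivity
  have hK₂0 : 0 ≤ K₂ := by positivity
  refine ⟨C₁ + C₂ + K₁ + K₂, by positivity, fun s hs t ht hst => ?_⟩
  have hsI : s ∈ Icc A B := ⟨ha.trans hs.1, hs.2.trans hv⟩
  have htI : t ∈ Icc A B := ⟨ha.trans ht.1, ht.2.trans hv⟩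
  have hw := h.τ_sub_nonneg hsI htI hst
  rcases le_total t u with htu | htu
  · obtain ⟨e1, e2⟩ := h₁ s ⟨hs.1, hst.trans htu⟩ t ⟨ht.1, htu⟩ hst
    exact ⟨e1.trans (mul_le_mul_of_nonneg_right (by linarith) (by positivity)),
      e2.trans (mul_le_mul_of_nonneg_right (by linarith) (by positivity))⟩
  rcases le_total u s with hus | hsu
  · obtain ⟨e1, e2⟩ := h₂ s ⟨hus, hs.2⟩ t ⟨htu, ht.2⟩ hst
    exact ⟨e1.trans (mul_le_mul_of_nonneg_right (by linarith) (by positivity)),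
      e2.trans (mul_le_mul_of_nonneg_right (by linarith) (by positivity))⟩
  obtain ⟨e1, e2⟩ := h₁ s ⟨hs.1, hsu⟩ u ⟨hau, le_rfl⟩ hsu
  obtain ⟨e3, e4⟩ := h₂ u ⟨le_rfl, huv⟩ t ⟨htu, ht.2⟩ htu
  have w1 := h.τ_sub_nonneg hsI huI hsu
  have w2 := h.τ_sub_nonneg huI htI htu
  have wM : τ t - τ s ≤ M := by
    have := h.τ_mono.monotoneOn hA hsI hsI.1
    have := h.τ_mono.monotoneOn htI hB htI.2
    linarith
  have l1 : τ u - τ s ≤ τ t - τ s := by linarith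
  have l2 : τ t - τ u ≤ τ t - τ s := by linarith
  constructor
  · have e : y t - y s = (y u - y s) + (y t - y u) := by abel
    rw [e]
    calc ‖(y u - y s) + (y t - y u)‖ ≤ C₁ * (τ u - τ s) ^ κ + C₂ * (τ t - τ u) ^ κ :=
          (norm_add_le _ _).trans (add_le_add e1 e3)
      _ ≤ C₁ * (τ t - τ s) ^ κ + C₂ * (τ t - τ s) ^ κ := by gcongr
      _ ≤ (C₁ + C₂ + K₁ + K₂) * (τ t - τ s) ^ κ := by
          rw [← add_mul]
          exact mul_le_mul_of_nonneg_right (by linarith) (by positivity)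
  · have e : y t - y s - g s (y s) (ω t - ω s) - Φ s t (y s) =
        (y u - y s - g s (y s) (ω u - ω s) - Φ s u (y s)) +
        (y t - y u - g u (y u) (ω t - ω u) - Φ u t (y u)) +
        (g u (y u) - g s (y s)) (ω t - ω u) + (Φ u t (y u) - Φ u t (y s)) := by
      have e1 : ω t - ω s = (ω t - ω u) + (ω u - ω s) := by abel
      rw [← h.drift_add s hsI u huI t htI hsu htu, e1]
      simp only [map_add, sub_apply]
      abel
    have d1 : ‖(g u (y u) - g s (y s)) (ω t - ω u)‖ ≤ K₁ * (τ t - τ s) ^ (γ + κ) := by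
      refine h.defect_le (by positivity) hsI huI htI hsu htu (e1.trans ?_)
      rw [mul_assoc]
      gcongr
      exact rpow_le_mul_rpow w1 (l1.trans wM) h.γ_lt.le hγ
    have d2 : ‖Φ u t (y u) - Φ u t (y s)‖ ≤ K₂ * (τ t - τ s) ^ (γ + κ) := by
      calc ‖Φ u t (y u) - Φ u t (y s)‖ ≤ Λ R * ‖y u - y s‖ * (τ t - τ u) :=
            h.drift_lip R hR0 u huI t htI htu _ _ (hyR u ⟨hau, le_rfl⟩) (hyR s ⟨hs.1, hsu⟩)
        _ ≤ Λ R * (C₁ * (τ t - τ s) ^ κ) * (M ^ (1 - γ) * (τ t - τ s) ^ γ) := by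
            gcongr
            · exact e1.trans (by gcongr)
            · refine l2.trans ?_
              simpa using rpow_le_mul_rpow hw wM (h.γ_lt.trans h.κ_lt).le hγ
        _ = K₂ * (τ t - τ s) ^ (γ + κ) := by
            rw [Real.rpow_add_of_nonneg hw hγ.le hκ.le, hK₂]; ring
    have hθ : 0 ≤ γ + κ := by linarith
    calc ‖y t - y s - g s (y s) (ω t - ω s) - Φ s t (y s)‖
        ≤ C₁ * (τ u - τ s) ^ (γ + κ) + C₂ * (τ t - τ u) ^ (γ + κ) +
          K₁ * (τ t - τ s) ^ (γ + κ) + K₂ * (τ t - τ s) ^ (γ + κ) := by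
          rw [e]
          exact norm_add₄_le.trans (by gcongr)
      _ ≤ C₁ * (τ t - τ s) ^ (γ + κ) + C₂ * (τ t - τ s) ^ (γ + κ) +
          K₁ * (τ t - τ s) ^ (γ + κ) + K₂ * (τ t - τ s) ^ (γ + κ) := by gcongr
      _ = (C₁ + C₂ + K₁ + K₂) * (τ t - τ s) ^ (γ + κ) := by ring

/-- Global existence of a path satisfying the one-step expansion. -/
theorem exists_davie [ProperSpace F] (h : RoughData A B κ γ τ ω g Φ H L G Λ) (hAB : A ≤ B)
    (x₀ : F) : ∃ y : ℝ → F, ∃ C, 0 ≤ C ∧ y A = x₀ ∧ IsDavieOn κ γ τ ω g Φ (Icc A B) C y := by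
  obtain ⟨η, hη, hloc⟩ := h.exists_local
  have hA : A ∈ Icc A B := ⟨le_rfl, hAB⟩
  have hB : B ∈ Icc A B := ⟨hAB, le_rfl⟩
  have key : ∀ n : ℕ, ∀ v ∈ Icc A B, τ v - τ A ≤ n * η →
      ∃ y : ℝ → F, ∃ C, 0 ≤ C ∧ y A = x₀ ∧ IsDavieOn κ γ τ ω g Φ (Icc A v) C y := by
    intro n
    induction n with
    | zero =>
      intro v hv hvn
      exact hloc x₀ A hA v hv hv.1 (by simp at hvn; linarith)
    | succ n ih =>
      intro v hv hvn
      by_cases hle : τ v - τ A ≤ n * η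
      · exact ih v hv hle
      push Not at hle
      have hn : 0 ≤ (n : ℝ) * η := by positivity
      push_cast at hvn
      obtain ⟨u, hu, hun⟩ := intermediate_value_Icc hv.1
        (h.τ_cont.mono (Icc_subset_Icc_right hv.2))
        (show τ A + n * η ∈ Icc (τ A) (τ v) from ⟨by linarith, by linarith⟩)
      have huI : u ∈ Icc A B := ⟨hu.1, hu.2.trans hv.2⟩
      obtain ⟨y₁, C₁, hC₁, hy₁0, hy₁⟩ := ih u huI (by linarith)
      obtain ⟨y₂, C₂, hC₂, hy₂0, hy₂⟩ := hloc (y₁ u) u huI v hv hu.2 (by linarith)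
      set y : ℝ → F := fun r => if r ≤ u then y₁ r else y₂ r with hy
      have ey1 : ∀ r ∈ Icc A u, y r = y₁ r := fun r hr => by simp [hy, hr.2]
      have ey2 : ∀ r ∈ Icc u v, y r = y₂ r := by
        intro r hr
        rcases hr.1.eq_or_lt with rfl | hlt
        · simp [hy, hy₂0]
        · simp [hy, not_le.2 hlt]
      obtain ⟨C, hC, hd⟩ := h.glue (y := y) hC₁ hC₂ le_rfl hu.1 hu.2 hv.2
        (fun s hs t ht hst => by rw [ey1 s hs, ey1 t ht]; exact hy₁ s hs t ht hst)
        (fun s hs t ht hst => by rw [ey2 s hs, ey2 t ht]; exact hy₂ s hs t ht hst)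
      exact ⟨y, C, hC, by rw [ey1 A ⟨le_rfl, hu.1⟩, hy₁0], hd⟩
  obtain ⟨n, hn⟩ := exists_nat_ge ((τ B - τ A) / η)
  exact key n B hB (by rwa [div_le_iff₀ hη] at hn)

end RoughData

lemma sum_fin_succ_sub {G : Type*} [AddCommGroup G] :
    ∀ (n : ℕ) (f : Fin (n + 1) → G), ∑ i : Fin n, (f i.succ - f i.castSucc) = f (Fin.last n) - f 0
  | 0, f => by simp
  | n + 1, f => by
    have := sum_fin_succ_sub n (fun i => f i.castSucc)
    rw [Fin.sum_univ_castSucc]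
    simp only [Fin.succ_castSucc, Fin.castSucc_zero, Fin.succ_last] at this ⊢
    rw [this]
    abel

lemma TaggedPartition.mem_Icc {a b : ℝ} (P : TaggedPartition a b) (i : Fin (P.n + 1)) :
    P.t i ∈ Icc a b := by
  have h1 := P.mono.monotone (Fin.zero_le i)
  have h2 := P.mono.monotone (Fin.le_last i)
  rw [P.first] at h1
  rw [P.last] at h2
  exact ⟨h1, h2⟩

lemma TaggedPartition.sub_le_mesh {a b : ℝ} (P : TaggedPartition a b) (i : Fin P.n) :
    P.t i.succ - P.t i.castSucc ≤ P.mesh :=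
  le_ciSup (f := fun i : Fin P.n => P.t i.succ - P.t i.castSucc) (Set.finite_range _).bddAbove i

lemma exists_taggedPartition {a b δ : ℝ} (hab : a ≤ b) (hδ : 0 < δ) :
    ∃ P : TaggedPartition a b, P.mesh < δ := by
  rcases hab.eq_or_lt with rfl | hab
  · refine ⟨⟨0, fun _ => a, fun _ => a, fun i j hij => by have := Fin.lt_def.1 hij; omega, rfl, rfl, fun i => i.elim0⟩, ?_⟩
    simpa [TaggedPartition.mesh, Real.iSup_of_isEmpty] using hδ
  · obtain ⟨N, hN⟩ := exists_nat_gt ((b - a) / δ)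
    have hba : 0 < b - a := sub_pos.2 hab
    have hN0 : (0 : ℝ) < N := (div_pos hba hδ).trans hN
    have hN1 : N ≠ 0 := by rintro rfl; simp at hN0
    have hstep : 0 < (b - a) / N := div_pos hba hN0
    refine ⟨⟨N, fun i => a + i * ((b - a) / N), fun i => a + i * ((b - a) / N), ?_, by simp, ?_,
      fun i => ?_⟩, ?_⟩
    · intro i j hij
      have : ((i : ℕ) : ℝ) < (j : ℕ) := by exact_mod_cast hij
      simp only
      gcongr
    · simp only [Fin.val_last]
      field_simp
      ring
    · simp only [Fin.val_castSucc, Fin.val_succ, Nat.cast_add, Nat.cast_one]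
      exact ⟨le_rfl, by linarith⟩
    · have : Nonempty (Fin N) := ⟨⟨0, Nat.pos_of_ne_zero hN1⟩⟩
      have : (b - a) / N < δ := by
        rw [div_lt_iff₀ hδ] at hN
        rw [div_lt_iff₀ hN0]; linarith
      refine lt_of_le_of_lt ?_ this
      unfold TaggedPartition.mesh
      refine ciSup_le fun i => ?_
      simp only [Fin.val_castSucc, Fin.val_succ, Nat.cast_add, Nat.cast_one]
      linarith

section Young

variable {E F : Type*} [NormedAddCommGroup E] [NormedSpace ℝ E]
  [NormedAddCommGroup F] [NormedSpace ℝ F]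

lemma IsYoungIntegral.unique {x : ℝ → E →L[ℝ] F} {ω : ℝ → E} {a b : ℝ} {v w : F} (hab : a ≤ b)
    (hv : IsYoungIntegral x ω a b v) (hw : IsYoungIntegral x ω a b w) : v = w := by
  refine eq_of_forall_dist_le fun ε hε => ?_
  obtain ⟨δ₁, hδ₁, h₁⟩ := hv (ε / 2) (by positivity)
  obtain ⟨δ₂, hδ₂, h₂⟩ := hw (ε / 2) (by positivity)
  obtain ⟨P, hP⟩ := exists_taggedPartition hab (lt_min hδ₁ hδ₂)
  have e₁ := h₁ P (hP.trans_le (min_le_left _ _))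
  have e₂ := h₂ P (hP.trans_le (min_le_right _ _))
  have e : v - w = -(RSSum x ω P - v) + (RSSum x ω P - w) := by abel
  rw [dist_eq_norm, e]
  refine (norm_add_le _ _).trans ?_
  rw [norm_neg]
  linarith

lemma IsYoungIntegral.youngIntegral_eq {x : ℝ → E →L[ℝ] F} {ω : ℝ → E} {a b : ℝ} {v : F}
    (hab : a ≤ b) (hv : IsYoungIntegral x ω a b v) : youngIntegral x ω a b = v := by
  have hex : ∃ v, IsYoungIntegral x ω a b v := ⟨v, hv⟩
  unfold youngIntegral
  rw [dif_pos hex]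
  exact IsYoungIntegral.unique hab hex.choose_spec hv

/-- A path whose increments are approximated by `x dω` up to a superlinear error is the
Young integral. -/
lemma isYoungIntegral_of_expansion {x : ℝ → E →L[ℝ] F} {ω : ℝ → E} {z : ℝ → F} {τ : ℝ → ℝ}
    {a b κ γ C : ℝ} (hab : a ≤ b) (hκ : 0 < κ) (hγ : 0 < γ) (hθ : 1 < γ + κ) (hC : 0 ≤ C)
    (hτc : ContinuousOn τ (Icc a b)) (hτm : MonotoneOn τ (Icc a b))
    (hω : ∀ s ∈ Icc a b, ∀ t ∈ Icc a b, s ≤ t → ‖ω t - ω s‖ ≤ (τ t - τ s) ^ κ)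
    (hx : ∀ s ∈ Icc a b, ∀ t ∈ Icc a b, s ≤ t → ‖x t - x s‖ ≤ C * (τ t - τ s) ^ γ)
    (hz : ∀ s ∈ Icc a b, ∀ t ∈ Icc a b, s ≤ t →
      ‖z t - z s - x s (ω t - ω s)‖ ≤ C * (τ t - τ s) ^ (γ + κ)) :
    IsYoungIntegral x ω a b (z b - z a) := by
  intro ε hε
  have hM : 0 ≤ τ b - τ a := sub_nonneg.2 (hτm ⟨le_rfl, hab⟩ ⟨hab, le_rfl⟩ hab)
  set M := τ b - τ a with hMdef
  have hθ' : 0 < γ + κ - 1 := by linarith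
  set ρ := (ε / (2 * C * M + 1)) ^ (1 / (γ + κ - 1)) with hρ
  have hρ0 : 0 < ρ := by positivity
  have hρe : ρ ^ (γ + κ - 1) = ε / (2 * C * M + 1) := by
    rw [hρ, ← Real.rpow_mul (by positivity), one_div_mul_cancel hθ'.ne', Real.rpow_one]
  have huc := isCompact_Icc.uniformContinuousOn_of_continuous hτc
  obtain ⟨δ, hδ, hδτ⟩ := Metric.uniformContinuousOn_iff.1 huc ρ hρ0
  refine ⟨δ, hδ, fun P hP => ?_⟩
  have htel : z b - z a = ∑ i : Fin P.n, (z (P.t i.succ) - z (P.t i.castSucc)) := by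
    rw [sum_fin_succ_sub P.n (fun i => z (P.t i)), P.first, P.last]
  have htelτ : M = ∑ i : Fin P.n, (τ (P.t i.succ) - τ (P.t i.castSucc)) := by
    rw [sum_fin_succ_sub P.n (fun i => τ (P.t i)), P.first, P.last]
  have hterm : ∀ i : Fin P.n, ‖x (P.tag i) (ω (P.t i.succ) - ω (P.t i.castSucc)) -
      (z (P.t i.succ) - z (P.t i.castSucc))‖ ≤
      2 * C * ρ ^ (γ + κ - 1) * (τ (P.t i.succ) - τ (P.t i.castSucc)) := by
    intro i
    set s := P.t i.castSucc with hs
    set t := P.t i.succ with ht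
    set r := P.tag i with hr
    have hsI : s ∈ Icc a b := P.mem_Icc _
    have htI : t ∈ Icc a b := P.mem_Icc _
    have hrm : r ∈ Icc s t := P.tag_mem i
    have hrI : r ∈ Icc a b := ⟨hsI.1.trans hrm.1, hrm.2.trans htI.2⟩
    have hst : s ≤ t := hrm.1.trans hrm.2
    have hw : 0 ≤ τ t - τ s := sub_nonneg.2 (hτm hsI htI hst)
    have hw1 : 0 ≤ τ r - τ s := sub_nonneg.2 (hτm hsI hrI hrm.1)
    have hw2 : τ r - τ s ≤ τ t - τ s := by linarith [hτm hrI htI hrm.2]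
    have hwρ : τ t - τ s ≤ ρ := by
      have h1 : t - s < δ := lt_of_le_of_lt (P.sub_le_mesh i) hP
      have h2 := hδτ t htI s hsI (by rw [Real.dist_eq, abs_of_nonneg (by linarith)]; exact h1)
      rw [Real.dist_eq, abs_of_nonneg hw] at h2
      exact h2.le
    have e : x r (ω t - ω s) - (z t - z s) =
        (x r - x s) (ω t - ω s) - (z t - z s - x s (ω t - ω s)) := by
      rw [sub_apply]; abel
    rw [e]
    calc ‖(x r - x s) (ω t - ω s) - (z t - z s - x s (ω t - ω s))‖
        ≤ ‖x r - x s‖ * ‖ω t - ω s‖ + C * (τ t - τ s) ^ (γ + κ) :=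
          (norm_sub_le _ _).trans
            (add_le_add (ContinuousLinearMap.le_opNorm _ _) (hz s hsI t htI hst))
      _ ≤ C * (τ t - τ s) ^ γ * (τ t - τ s) ^ κ + C * (τ t - τ s) ^ (γ + κ) := by
          gcongr
          · exact (hx s hsI r hrI hrm.1).trans (by gcongr)
          · exact hω s hsI t htI hst
      _ = 2 * C * (τ t - τ s) ^ (γ + κ) := by
          rw [Real.rpow_add_of_nonneg hw hγ.le hκ.le]; ring
      _ ≤ 2 * C * (ρ ^ (γ + κ - 1) * (τ t - τ s)) := by
          gcongr
          simpa using rpow_le_mul_rpow hw hwρ hθ.le one_pos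
      _ = 2 * C * ρ ^ (γ + κ - 1) * (τ t - τ s) := by ring
  calc ‖RSSum x ω P - (z b - z a)‖
      = ‖∑ i : Fin P.n, (x (P.tag i) (ω (P.t i.succ) - ω (P.t i.castSucc)) -
          (z (P.t i.succ) - z (P.t i.castSucc)))‖ := by
        rw [Finset.sum_sub_distrib, htel, RSSum]
    _ ≤ ∑ i : Fin P.n, 2 * C * ρ ^ (γ + κ - 1) * (τ (P.t i.succ) - τ (P.t i.castSucc)) :=
        norm_sum_le_of_le _ fun i _ => hterm i
    _ = 2 * C * M * (ε / (2 * C * M + 1)) := by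
        rw [← Finset.mul_sum, ← htelτ, hρe]; ring
    _ < ε := by
        have : 0 < 2 * C * M + 1 := by positivity
        rw [← mul_div_assoc, div_lt_iff₀ this]
        nlinarith

/-- Existence of the indefinite Young integral together with its one-step expansion. -/
lemma exists_young [ProperSpace F] {x : ℝ → E →L[ℝ] F} {ω : ℝ → E} {τ : ℝ → ℝ}
    {a b κ γ H : ℝ} (hab : a ≤ b) (hκ1 : κ < 1) (hγ : 0 < γ) (hγκ : γ < κ) (hθ : 1 < γ + κ)
    (hH : 0 ≤ H) (hτc : ContinuousOn τ (Icc a b)) (hτm : StrictMonoOn τ (Icc a b))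
    (hω : ∀ s ∈ Icc a b, ∀ t ∈ Icc a b, s ≤ t → ‖ω t - ω s‖ ≤ (τ t - τ s) ^ κ)
    (hx : ∀ s ∈ Icc a b, ∀ t ∈ Icc a b, s ≤ t → ‖x t - x s‖ ≤ H * (τ t - τ s) ^ γ) :
    ∃ z : ℝ → F, ∃ C, 0 ≤ C ∧ z a = 0 ∧ (∀ t ∈ Icc a b, youngIntegral x ω a t = z t) ∧
      ∀ s ∈ Icc a b, ∀ t ∈ Icc a b, s ≤ t →
        ‖z t - z s - x s (ω t - ω s)‖ ≤ C * (τ t - τ s) ^ (γ + κ) := by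
  have hM : 0 ≤ τ b - τ a := sub_nonneg.2 (hτm.monotoneOn ⟨le_rfl, hab⟩ ⟨hab, le_rfl⟩ hab)
  have hτ0 : ∀ s ∈ Icc a b, ∀ t ∈ Icc a b, s ≤ t → 0 ≤ τ t - τ s := fun s hs t ht hst =>
    sub_nonneg.2 (hτm.monotoneOn hs ht hst)
  have hdata : RoughData a b κ γ τ ω (fun s (_ : F) => x s) (fun _ _ _ => 0) H 0
      (‖x a‖ + H * (τ b - τ a) ^ γ) (fun _ => 0) :=
    { κ_lt := hκ1
      γ_pos := hγ
      γ_lt := hγκ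
      one_lt := hθ
      H_nonneg := hH
      L_nonneg := le_rfl
      G_nonneg := by positivity
      τ_cont := hτc
      τ_mono := hτm
      ω_le := hω
      g_le := fun s hs t ht hst _ _ => by simpa using hx s hs t ht hst
      g_growth := fun s hs _ => by
        have e : x s = x a + (x s - x a) := by abel
        rw [e, zero_mul, add_zero]
        refine (norm_add_le _ _).trans ((add_le_add_iff_left _).2 ?_)
        refine (hx a ⟨le_rfl, hab⟩ s hs hs.1).trans ?_
        have h1 := hτ0 a ⟨le_rfl, hab⟩ s hs hs.1
        have h2 := hτm.monotoneOn hs ⟨hab, le_rfl⟩ hs.2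
        gcongr
      drift_add := by simp
      drift_growth := fun s hs t ht hst y => by
        simpa using mul_nonneg (by positivity) (hτ0 s hs t ht hst)
      Λ_nonneg := by simp
      drift_lip := by simp }
  obtain ⟨z, C, hC, hz0, hz⟩ := hdata.exists_davie hab 0
  refine ⟨z, C, hC, hz0, fun t ht => ?_, fun s hs t ht hst => by
    simpa using (hz s hs t ht hst).2⟩
  have hsub : Icc a t ⊆ Icc a b := Icc_subset_Icc_right ht.2
  have := isYoungIntegral_of_expansion (x := x) (ω := ω) (z := z) (C := max C H) ht.1
    (hγ.trans hγκ) hγ hθ (le_max_of_le_left hC) (hτc.mono hsub) (hτm.monotoneOn.mono hsub)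
    (fun s hs t ht hst => hω s (hsub hs) t (hsub ht) hst)
    (fun s hs t ht hst => (hx s (hsub hs) t (hsub ht) hst).trans
      (mul_le_mul_of_nonneg_right (le_max_right _ _)
        (Real.rpow_nonneg (hτ0 s (hsub hs) t (hsub ht) hst) _)))
    (fun s hs t ht hst => by
      have := (hz s (hsub hs) t (hsub ht) hst).2
      rw [sub_zero] at this
      exact this.trans (mul_le_mul_of_nonneg_right (le_max_left _ _)
        (Real.rpow_nonneg (hτ0 s (hsub hs) t (hsub ht) hst) _)))
  rw [IsYoungIntegral.youngIntegral_eq ht.1 this, hz0, sub_zero]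

/-- Uniqueness for linear-type rough relations: `z` vanishes if its increments are governed by
`v dω` and a drift, both controlled by `z` itself. -/
lemma eq_zero_of_linear_rough {z Ψ : ℝ → F} {v : ℝ → E →L[ℝ] F} {ω : ℝ → E} {τ : ℝ → ℝ}
    {a b κ γ C L K Λ : ℝ} (hκ1 : κ < 1) (hγ : 0 < γ) (hγκ : γ < κ)
    (hθ : 1 < γ + κ) (hC : 0 ≤ C) (hL : 0 ≤ L) (hK : 0 ≤ K) (hΛ : 0 ≤ Λ)
    (hτc : ContinuousOn τ (Icc a b)) (hτm : StrictMonoOn τ (Icc a b))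
    (hω : ∀ s ∈ Icc a b, ∀ t ∈ Icc a b, s ≤ t → ‖ω t - ω s‖ ≤ (τ t - τ s) ^ κ)
    (hzc : ContinuousOn z (Icc a b))
    (hz : ∀ s ∈ Icc a b, ∀ t ∈ Icc a b, s ≤ t → ‖z t - z s‖ ≤ C * (τ t - τ s) ^ γ)
    (hJ : ∀ s ∈ Icc a b, ∀ t ∈ Icc a b, s ≤ t →
      ‖z t - z s - v s (ω t - ω s) - (Ψ t - Ψ s)‖ ≤ C * (τ t - τ s) ^ (γ + κ))
    (hv : ∀ s ∈ Icc a b, ‖v s‖ ≤ L * ‖z s‖)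
    (hvd : ∀ s ∈ Icc a b, ∀ t ∈ Icc a b, s ≤ t →
      ‖v t - v s‖ ≤ L * ‖z t - z s‖ + K * (τ t - τ s) ^ γ * ‖z s‖)
    (hΨ : ∀ s ∈ Icc a b, ∀ t ∈ Icc a b, s ≤ t → ∀ M, (∀ r ∈ Icc s t, ‖z r‖ ≤ M) →
      ‖Ψ t - Ψ s‖ ≤ Λ * M * (τ t - τ s))
    (hza : z a = 0) : ∀ t ∈ Icc a b, z t = 0 := by
  have hκ : 0 < κ := hγ.trans hγκ
  have hκγ : 0 < κ - γ := sub_pos.2 hγκ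
  have hsC := sewC_pos hθ
  set c := sewC (γ + κ) with hc
  set C₁ := c * (L + K) + L + Λ + 1 with hC₁
  have hC₁1 : 1 ≤ C₁ := by
    have : 0 ≤ c * (L + K) := by positivity
    linarith
  set η := (1 / (2 * C₁)) ^ (1 / (κ - γ)) with hη
  have hη0 : 0 < η := by positivity
  have hη1 : η ≤ 1 := Real.rpow_le_one (by positivity)
    (by rw [div_le_one (by positivity)]; linarith) (by positivity)
  have hηC : C₁ * η ^ (κ - γ) = 1 / 2 := by
    rw [hη, ← Real.rpow_mul (by positivity), one_div_mul_cancel hκγ.ne', Real.rpow_one]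
    field_simp
  have hτ0 : ∀ s ∈ Icc a b, ∀ t ∈ Icc a b, s ≤ t → 0 ≤ τ t - τ s := fun s hs t ht hst =>
    sub_nonneg.2 (hτm.monotoneOn hs ht hst)
  -- vanishing propagates over intervals that are short for the clock
  have hprop : ∀ s₀ ∈ Icc a b, ∀ s₁ ∈ Icc a b, s₀ ≤ s₁ → τ s₁ - τ s₀ ≤ η → z s₀ = 0 →
      ∀ t ∈ Icc s₀ s₁, z t = 0 := by
    intro s₀ hs₀ s₁ hs₁ hs hτη hz0 t₀ ht₀
    have hsub : Icc s₀ s₁ ⊆ Icc a b := Icc_subset_Icc hs₀.1 hs₁.2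
    have hs₀I : s₀ ∈ Icc s₀ s₁ := ⟨le_rfl, hs⟩
    have hτ1 : ∀ s ∈ Icc s₀ s₁, ∀ t ∈ Icc s₀ s₁, s ≤ t → τ t - τ s ≤ η := by
      intro s hs t ht _
      have e1 := hτm.monotoneOn hs₀ (hsub hs) hs.1
      have e2 := hτm.monotoneOn (hsub ht) hs₁ ht.2
      linarith
    have hcontr := le_of_contract (c := 1 / 2) (K := 0) (N₀ := C) (X := ‖z t₀ - z s₀‖)
      (Y := (τ t₀ - τ s₀) ^ γ)
      (P := fun N => ∀ s ∈ Icc s₀ s₁, ∀ t ∈ Icc s₀ s₁, s ≤ t →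
        ‖z t - z s‖ ≤ N * (τ t - τ s) ^ γ)
      (by norm_num) (by norm_num) le_rfl hC
      (fun s hs t ht hst => hz s (hsub hs) t (hsub ht) hst) ?_
      (fun N hN => hN s₀ hs₀I t₀ ht₀ ht₀.1)
    · simpa [hz0] using hcontr
    intro N hN hP
    have hzN : ∀ t ∈ Icc s₀ s₁, ‖z t‖ ≤ N := by
      intro t ht
      have e := hP s₀ hs₀I t ht ht.1
      rw [hz0, sub_zero] at e
      have e2 : (τ t - τ s₀) ^ γ ≤ 1 := Real.rpow_le_one (hτ0 s₀ hs₀ t (hsub ht) ht.1)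
        ((hτ1 s₀ hs₀I t ht ht.1).trans hη1) hγ.le
      nlinarith
    have hJb := sewing_bound (S := Icc s₀ s₁) (τ := τ)
      (J := fun s t => z t - z s - v s (ω t - ω s) - (Ψ t - Ψ s)) (θ := γ + κ)
      (K := (L + K) * N) hθ (by positivity) hC (hτm.monotoneOn.mono hsub) ?_ ?_
      (fun s hs t ht hst => hJ s (hsub hs) t (hsub ht) hst)
    · intro s hs t ht hst
      have hw := hτ0 s (hsub hs) t (hsub ht) hst
      have hw1 := hτ1 s hs t ht hst
      have b1 := hJb s hs t ht hst
      have b2 : ‖v s (ω t - ω s)‖ ≤ L * N * (τ t - τ s) ^ κ := by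
        refine (ContinuousLinearMap.le_opNorm _ _).trans ?_
        gcongr
        · exact (hv s (hsub hs)).trans (by gcongr; exact hzN s hs)
        · exact hω s (hsub hs) t (hsub ht) hst
      have b3 := hΨ s (hsub hs) t (hsub ht) hst N
        (fun r hr => hzN r ⟨hs.1.trans hr.1, hr.2.trans ht.2⟩)
      have p1 : (τ t - τ s) ^ (γ + κ) ≤ (τ t - τ s) ^ κ := by
        simpa using rpow_le_mul_rpow hw (hw1.trans hη1) (show κ ≤ γ + κ by linarith) hκ
      have p2 : (τ t - τ s) ≤ (τ t - τ s) ^ κ := by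
        simpa using rpow_le_mul_rpow hw (hw1.trans hη1) hκ1.le hκ
      have p3 := rpow_le_mul_rpow hw hw1 hγκ.le hγ
      have e : z t - z s = (z t - z s - v s (ω t - ω s) - (Ψ t - Ψ s)) + v s (ω t - ω s) +
          (Ψ t - Ψ s) := by abel
      calc ‖z t - z s‖ ≤ c * ((L + K) * N) * (τ t - τ s) ^ (γ + κ) +
            L * N * (τ t - τ s) ^ κ + Λ * N * (τ t - τ s) := by
            rw [e]; exact norm_add₃_le.trans (by gcongr)
        _ ≤ c * ((L + K) * N) * (τ t - τ s) ^ κ + L * N * (τ t - τ s) ^ κ +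
            Λ * N * (τ t - τ s) ^ κ + N * (τ t - τ s) ^ κ := by
            have : 0 ≤ N * (τ t - τ s) ^ κ := by positivity
            refine le_add_of_le_of_nonneg ?_ this
            gcongr
        _ = C₁ * N * (τ t - τ s) ^ κ := by rw [hC₁]; ring
        _ ≤ C₁ * N * (η ^ (κ - γ) * (τ t - τ s) ^ γ) := by gcongr
        _ = C₁ * η ^ (κ - γ) * N * (τ t - τ s) ^ γ := by ring
        _ = (1 / 2 * N + 0) * (τ t - τ s) ^ γ := by rw [hηC]; ring
    · intro s hs t ht hst
      obtain ⟨u, hu, hum⟩ := intermediate_value_Icc hst.le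
        (hτc.mono (Icc_subset_Icc (hsub hs).1 (hsub ht).2))
        (show (τ s + τ t) / 2 ∈ Icc (τ s) (τ t) from by
          have := hτm.monotoneOn (hsub hs) (hsub ht) hst.le
          exact ⟨by linarith, by linarith⟩)
      have huI : u ∈ Icc s₀ s₁ := ⟨hs.1.trans hu.1, hu.2.trans ht.2⟩
      exact ⟨u, huI, u, huI, hu.1, le_rfl, hu.2, by linarith, by linarith, by simp⟩
    · intro s hs u hu t ht hsu hut
      have hw := hτ0 s (hsub hs) t (hsub ht) (hsu.trans hut)
      have w1 := hτ0 s (hsub hs) u (hsub hu) hsu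
      have w2 := hτ0 u (hsub hu) t (hsub ht) hut
      have l1 : τ u - τ s ≤ τ t - τ s := by linarith
      have l2 : τ t - τ u ≤ τ t - τ s := by linarith
      have e1 : ω t - ω s = (ω t - ω u) + (ω u - ω s) := by abel
      have e : (z t - z s - v s (ω t - ω s) - (Ψ t - Ψ s)) -
          (z u - z s - v s (ω u - ω s) - (Ψ u - Ψ s)) -
          (z t - z u - v u (ω t - ω u) - (Ψ t - Ψ u)) = (v u - v s) (ω t - ω u) := by
        simp only [e1, map_add, sub_apply]
        abel
      rw [e]
      calc ‖(v u - v s) (ω t - ω u)‖ ≤ ‖v u - v s‖ * ‖ω t - ω u‖ :=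
            ContinuousLinearMap.le_opNorm _ _
        _ ≤ (L * (N * (τ t - τ s) ^ γ) + K * (τ t - τ s) ^ γ * N) * (τ t - τ s) ^ κ := by
            gcongr
            · refine (hvd s (hsub hs) u (hsub hu) hsu).trans ?_
              gcongr
              · exact (hP s hs u hu hsu).trans (by gcongr)
              · exact hzN s hs
            · exact (hω u (hsub hu) t (hsub ht) hut).trans (by gcongr)
        _ = (L + K) * N * (τ t - τ s) ^ (γ + κ) := by
            rw [Real.rpow_add_of_nonneg hw hγ.le hκ.le]; ring
  have hclosed : IsClosed ({t | z t = 0} ∩ Icc a b) := by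
    have := hzc.preimage_isClosed_of_isClosed isClosed_Icc (isClosed_singleton (x := (0 : F)))
    rwa [inter_comm] at this
  refine hclosed.Icc_subset_of_forall_mem_nhdsWithin hza ?_
  rintro s₀ ⟨hs₀, hs₀I⟩
  have hs₀' : s₀ ∈ Icc a b := ⟨hs₀I.1, hs₀I.2.le⟩
  have hev : ∀ᶠ t in nhdsWithin s₀ (Icc a b), τ t < τ s₀ + η :=
    (hτc s₀ hs₀').eventually_lt_const (by linarith)
  have hle : nhdsWithin s₀ (Ioi s₀) ≤ nhdsWithin s₀ (Icc a b) := by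
    refine nhdsWithin_le_of_mem ?_
    exact Filter.mem_of_superset (Ioo_mem_nhdsGT hs₀I.2)
      (fun t ht => ⟨hs₀I.1.trans ht.1.le, ht.2.le⟩)
  filter_upwards [hle hev, Ioo_mem_nhdsGT hs₀I.2] with t ht htI
  exact hprop s₀ hs₀' t ⟨hs₀I.1.trans htI.1.le, htI.2.le⟩ htI.1.le (by linarith) hs₀ t
    ⟨htI.1.le, le_rfl⟩

end Young

section Control

variable {E : Type*} [NormedAddCommGroup E]

/-- `VarSum p x s t v`: some chain `s = t₀ ≤ t₁ ≤ ⋯ ≤ tₙ = t` has `p`-variation sum `v`. -/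
inductive VarSum (p : ℝ) (x : ℝ → E) (s : ℝ) : ℝ → ℝ → Prop
  | nil : VarSum p x s s 0
  | snoc {t t' v : ℝ} : VarSum p x s t v → t ≤ t' → VarSum p x s t' (v + ‖x t' - x t‖ ^ p)

variable {p : ℝ} {x : ℝ → E} {a b s t u v w : ℝ}

lemma VarSum.le (h : VarSum p x s t v) : s ≤ t := by
  induction h with
  | nil => exact le_rfl
  | snoc _ h ih => exact ih.trans h

lemma VarSum.trans (h : VarSum p x s t v) (h' : VarSum p x t u w) : VarSum p x s u (v + w) := by
  induction h' with
  | nil => simpa using h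
  | snoc _ h'' ih => rw [← add_assoc]; exact ih.snoc h''

lemma VarSum.mem_pVarSums (hp : 0 < p) (h : VarSum p x s t v) : v ∈ pVarSums p x s t := by
  induction h with
  | nil =>
    exact ⟨0, fun _ => s, fun i j hij => by have := Fin.lt_def.1 hij; omega, rfl, rfl, by simp⟩
  | @snoc t t' v _ hle ih =>
    rcases hle.eq_or_lt with rfl | hlt
    · simpa [Real.zero_rpow hp.ne'] using ih
    · obtain ⟨n, c, hc, hc0, hcl, rfl⟩ := ih
      refine ⟨n + 1, Fin.snoc (α := fun _ => ℝ) c t', ?_, ?_, ?_, ?_⟩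
      · rw [Fin.strictMono_iff_lt_succ]
        intro i
        induction i using Fin.lastCases with
        | last => simpa [← hcl] using hlt
        | cast i =>
          rw [Fin.succ_castSucc, Fin.snoc_castSucc, Fin.snoc_castSucc]
          exact hc i.castSucc_lt_succ
      · rw [← Fin.castSucc_zero, Fin.snoc_castSucc, hc0]
      · rw [Fin.snoc_last]
      · rw [Fin.sum_univ_castSucc]
        congr 1
        · refine Finset.sum_congr rfl fun i _ => ?_
          rw [Fin.succ_castSucc, Fin.snoc_castSucc, Fin.snoc_castSucc]
        · rw [Fin.succ_last, Fin.snoc_last, Fin.snoc_castSucc, hcl]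

lemma VarSum.split (h : VarSum p x s u v) (hst : s ≤ t) (htu : t < u) :
    ∃ c d v₁ v₂, c ∈ Icc s t ∧ d ∈ Ioc t u ∧ VarSum p x s c v₁ ∧ VarSum p x d u v₂ ∧
      v = v₁ + ‖x d - x c‖ ^ p + v₂ := by
  induction h with
  | nil => exact absurd htu hst.not_gt
  | @snoc r u v h hru ih =>
    rcases le_or_gt r t with hrt | htr
    · exact ⟨r, u, v, 0, ⟨h.le, hrt⟩, ⟨htu, le_rfl⟩, h, .nil, by simp⟩
    · obtain ⟨c, d, v₁, v₂, hc, hd, h₁, h₂, rfl⟩ := ih htr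
      exact ⟨c, d, v₁, _, hc, ⟨hd.1, hd.2.trans hru⟩, h₁, h₂.snoc hru, by rw [add_assoc]⟩

lemma VarSum.eventually_lt (hp : 0 < p) (hx : ContinuousOn x (Icc a b)) (h : VarSum p x a t v)
    (htb : t ≤ b) {ε : ℝ} (hε : 0 < ε) :
    ∀ᶠ r in nhdsWithin t (Icc a b), ∃ v', VarSum p x a r v' ∧ v - ε < v' := by
  induction h with
  | nil =>
    filter_upwards [self_mem_nhdsWithin] with r hr
    refine ⟨_, VarSum.nil.snoc hr.1, ?_⟩
    have : 0 ≤ ‖x r - x a‖ ^ p := by positivity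
    linarith
  | @snoc t₁ t v h hle ih =>
    rcases hle.eq_or_lt with rfl | hlt
    · simpa [Real.zero_rpow hp.ne'] using ih htb
    · have htI : t ∈ Icc a b := ⟨h.le.trans hle, htb⟩
      have hc : ContinuousWithinAt (fun r => v + ‖x r - x t₁‖ ^ p) (Icc a b) t :=
        continuousWithinAt_const.add
          (((hx t htI).sub continuousWithinAt_const).norm.rpow_const (Or.inr hp.le))
      filter_upwards [hc.eventually_const_lt (show v + ‖x t - x t₁‖ ^ p - ε < _ by linarith),
        mem_nhdsWithin_of_mem_nhds (Ioi_mem_nhds hlt)] with r hr hr'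
      exact ⟨_, h.snoc (le_of_lt hr'), hr⟩

/-- The `p`-variation of a continuous path is dominated by the increments of a continuous
monotone function. -/
lemma exists_clock (hp : 0 < p) (hx : ContinuousOn x (Icc a b)) (hv : FinitePVar p x a b) :
    ∃ V : ℝ → ℝ, ContinuousOn V (Icc a b) ∧ MonotoneOn V (Icc a b) ∧
      ∀ s ∈ Icc a b, ∀ t ∈ Icc a b, s ≤ t → ‖x t - x s‖ ^ p ≤ V t - V s := by
  obtain ⟨B, hB⟩ := hv
  have hbdd : ∀ t ≤ b, BddAbove {v | VarSum p x a t v} := by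
    refine fun t ht => ⟨B, fun v hv => ?_⟩
    have h1 := hB ((VarSum.snoc hv ht).mem_pVarSums hp)
    have h2 : 0 ≤ ‖x b - x t‖ ^ p := by positivity
    linarith
  set V : ℝ → ℝ := fun t => sSup {v | VarSum p x a t v} with hV
  have hne : ∀ t, a ≤ t → {v | VarSum p x a t v}.Nonempty := fun t ht => ⟨_, VarSum.nil.snoc ht⟩
  have hle : ∀ {t v}, t ≤ b → VarSum p x a t v → v ≤ V t := fun ht h => le_csSup (hbdd _ ht) h
  have hadd : ∀ {s t w}, a ≤ s → t ≤ b → VarSum p x s t w → V s + w ≤ V t := by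
    intro s t w hs ht h
    rw [← le_sub_iff_add_le]
    refine csSup_le (hne s hs) fun v hv => ?_
    have := hle ht (VarSum.trans hv h)
    linarith
  have hincr : ∀ s ∈ Icc a b, ∀ t ∈ Icc a b, s ≤ t → ‖x t - x s‖ ^ p ≤ V t - V s := by
    intro s hs t ht hst
    have := hadd hs.1 ht.2 (VarSum.nil.snoc (p := p) (x := x) hst)
    linarith
  have hmono : MonotoneOn V (Icc a b) := by
    intro s hs t ht hst
    have h1 := hincr s hs t ht hst
    have h2 : 0 ≤ ‖x t - x s‖ ^ p := by positivity
    linarith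
  refine ⟨V, fun t ht => ?_, hmono, hincr⟩
  have hab : a ≤ b := ht.1.trans ht.2
  refine tendsto_order.2 ⟨fun y hy => ?_, fun y hy => ?_⟩
  · obtain ⟨v, hv, hyv⟩ := exists_lt_of_lt_csSup (hne t ht.1) hy
    filter_upwards [VarSum.eventually_lt hp hx hv ht.2 (sub_pos.2 hyv), self_mem_nhdsWithin]
      with r hr hrI
    obtain ⟨v', hv', hlt⟩ := hr
    have := hle hrI.2 hv'
    linarith
  · rcases ht.2.eq_or_lt with rfl | htb
    · filter_upwards [self_mem_nhdsWithin] with r hr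
      exact (hmono hr ht hr.2).trans_lt hy
    suffices h : ∃ u ∈ Ioc t b, V u < y by
      obtain ⟨u, hu, huy⟩ := h
      filter_upwards [self_mem_nhdsWithin, mem_nhdsWithin_of_mem_nhds (Iio_mem_nhds hu.1)]
        with r hr hru
      exact (hmono hr ⟨ht.1.trans hu.1.le, hu.2⟩ (le_of_lt hru)).trans_lt huy
    obtain ⟨ε, hε, hεy⟩ : ∃ ε, 0 < ε ∧ V t + 3 * ε ≤ y := ⟨(y - V t) / 3, by linarith, by linarith⟩
    have hφ : ContinuousOn (fun z : ℝ × ℝ => ‖x z.2 - x z.1‖ ^ p) (Icc a b ×ˢ Icc a b) := by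
      refine ContinuousOn.rpow_const (ContinuousOn.norm (ContinuousOn.sub ?_ ?_))
        fun _ _ => Or.inr hp.le
      · exact hx.comp continuousOn_snd fun z hz => hz.2
      · exact hx.comp continuousOn_fst fun z hz => hz.1
    obtain ⟨ρ, hρ, hρφ⟩ := Metric.uniformContinuousOn_iff.1
      ((isCompact_Icc.prod isCompact_Icc).uniformContinuousOn_of_continuous hφ) ε hε
    set ℓ := sInf (V '' Ioc t b) with hℓ
    have hℓb : BddBelow (V '' Ioc t b) := by
      refine ⟨V t, ?_⟩
      rintro _ ⟨r, hr, rfl⟩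
      exact hmono ht ⟨ht.1.trans hr.1.le, hr.2⟩ hr.1.le
    obtain ⟨_, ⟨u₀, hu₀, rfl⟩, hu₀ℓ⟩ := exists_lt_of_csInf_lt
      ((show (Ioc t b).Nonempty from ⟨b, htb, le_rfl⟩).image V) (show sInf (V '' Ioc t b) < ℓ + ε by linarith)
    obtain ⟨u, hu⟩ : ∃ u, u = min u₀ (t + ρ / 2) := ⟨_, rfl⟩
    have htu : t < u := hu ▸ lt_min hu₀.1 (by linarith)
    have huu : u ≤ u₀ := hu ▸ min_le_left _ _
    have huρ : u ≤ t + ρ / 2 := hu ▸ min_le_right _ _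
    have hub : u ≤ b := huu.trans hu₀.2
    have huI : u ∈ Icc a b := ⟨ht.1.trans htu.le, hub⟩
    have huℓ : V u < ℓ + ε := (hmono huI ⟨ht.1.trans hu₀.1.le, hu₀.2⟩ huu).trans_lt hu₀ℓ
    refine ⟨u, ⟨htu, hub⟩, ?_⟩
    obtain ⟨v, hv, huv⟩ := exists_lt_of_lt_csSup (hne u huI.1) (show V u - ε < V u by linarith)
    obtain ⟨c, d, v₁, v₂, hc, hd, h₁, h₂, rfl⟩ := VarSum.split hv ht.1 htu
    have hcI : c ∈ Icc a b := ⟨hc.1, hc.2.trans ht.2⟩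
    have hdI : d ∈ Icc a b := ⟨ht.1.trans hd.1.le, hd.2.trans hub⟩
    have e1 : ℓ ≤ V d := csInf_le hℓb ⟨d, ⟨hd.1, hdI.2⟩, rfl⟩
    have e2 := hadd hdI.1 hub h₂
    have e3 := hle ht.2 (h₁.snoc hc.2)
    have e4 := hρφ (c, d) ⟨hcI, hdI⟩ (c, t) ⟨hcI, ht⟩ (by
      rw [Prod.dist_eq, dist_self, Real.dist_eq, abs_of_pos (sub_pos.2 hd.1)]
      exact max_lt hρ (by linarith [hd.2]))
    rw [Real.dist_eq, abs_lt] at e4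
    simp only at e4
    linarith [e4.2]

/-- Paths dominated by a power of a clock have finite variation. -/
lemma finitePVar_of_le {τ : ℝ → ℝ} {κ r C : ℝ} (hC : 0 ≤ C) (hr : 0 < r) (hκr : 1 ≤ κ * r)
    (hτm : MonotoneOn τ (Icc a b))
    (hx : ∀ s ∈ Icc a b, ∀ t ∈ Icc a b, s ≤ t → ‖x t - x s‖ ≤ C * (τ t - τ s) ^ κ) :
    FinitePVar r x a b := by
  refine ⟨C ^ r * (τ b - τ a) ^ (κ * r - 1) * (τ b - τ a), ?_⟩
  rintro _ ⟨n, c, hc, rfl, rfl, rfl⟩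
  have hcI : ∀ i, c i ∈ Icc (c 0) (c (Fin.last n)) := fun i =>
    ⟨hc.monotone (Fin.zero_le i), hc.monotone (Fin.le_last i)⟩
  have h0 := hcI 0
  have hl := hcI (Fin.last n)
  rw [← sum_fin_succ_sub n (fun i => τ (c i)), Finset.mul_sum, sum_fin_succ_sub n (fun i => τ (c i))]
  refine Finset.sum_le_sum fun i _ => ?_
  have hi := hcI i.castSucc
  have hj := hcI i.succ
  have hij := (hc i.castSucc_lt_succ).le
  have hw := sub_nonneg.2 (hτm hi hj hij)
  have hw' : τ (c i.succ) - τ (c i.castSucc) ≤ τ (c (Fin.last n)) - τ (c 0) := by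
    linarith [hτm h0 hi hi.1, hτm hj hl hj.2]
  calc ‖x (c i.succ) - x (c i.castSucc)‖ ^ r
      ≤ (C * (τ (c i.succ) - τ (c i.castSucc)) ^ κ) ^ r :=
        Real.rpow_le_rpow (norm_nonneg _) (hx _ hi _ hj hij) hr.le
    _ = C ^ r * (τ (c i.succ) - τ (c i.castSucc)) ^ (κ * r) := by
        rw [Real.mul_rpow hC (by positivity), Real.rpow_mul hw]
    _ ≤ C ^ r * ((τ (c (Fin.last n)) - τ (c 0)) ^ (κ * r - 1) *
          (τ (c i.succ) - τ (c i.castSucc))) := by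
        gcongr
        simpa using rpow_le_mul_rpow hw hw' hκr one_pos
    _ = _ := by ring

end Control

lemma continuousOn_of_le_rpow {F : Type*} [NormedAddCommGroup F] {y : ℝ → F} {τ : ℝ → ℝ}
    {a b C κ : ℝ} (hκ : 0 < κ) (hτc : ContinuousOn τ (Icc a b)) (hτm : MonotoneOn τ (Icc a b))
    (hy : ∀ s ∈ Icc a b, ∀ t ∈ Icc a b, s ≤ t → ‖y t - y s‖ ≤ C * (τ t - τ s) ^ κ) :
    ContinuousOn y (Icc a b) := by
  intro s hs
  have h0 : Filter.Tendsto (fun t => C * |τ t - τ s| ^ κ) (nhdsWithin s (Icc a b)) (nhds 0) := by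
    have h1 : ContinuousWithinAt (fun t => C * |τ t - τ s| ^ κ) (Icc a b) s :=
      continuousWithinAt_const.mul
        (((hτc s hs).sub continuousWithinAt_const).abs.rpow_const (Or.inr hκ.le))
    simpa [ContinuousWithinAt, Real.zero_rpow hκ.ne'] using h1
  rw [ContinuousWithinAt, tendsto_iff_norm_sub_tendsto_zero]
  refine squeeze_zero' (Filter.Eventually.of_forall fun _ => norm_nonneg _) ?_ h0
  filter_upwards [self_mem_nhdsWithin] with t ht
  rcases le_total s t with hst | hts
  · rw [abs_of_nonneg (sub_nonneg.2 (hτm hs ht hst))]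
    exact hy s hs t ht hst
  · rw [abs_sub_comm, norm_sub_rev, abs_of_nonneg (sub_nonneg.2 (hτm ht hs hts))]
    exact hy t ht s hs hts

/-- Mean value estimate for the second-order difference of two maps. -/
lemma norm_second_difference_le {F G : Type*} [NormedAddCommGroup F] [NormedSpace ℝ F]
    [NormedAddCommGroup G] [NormedSpace ℝ G] {g₁ g₂ : F → G} {D₁ D₂ : F → F →L[ℝ] G}
    {x x' z z' : F} {L R M δ ε : ℝ}
    (h₁ : ∀ y, HasFDerivAt g₁ (D₁ y) y) (h₂ : ∀ y, HasFDerivAt g₂ (D₂ y) y)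
    (hL : ∀ y y', ‖g₂ y - g₂ y'‖ ≤ L * ‖y - y'‖)
    (hM : ∀ y y', ‖y‖ ≤ R → ‖y'‖ ≤ R → ‖D₂ y - D₂ y'‖ ≤ M * ‖y - y'‖ ^ δ)
    (hε : ∀ y, ‖D₂ y - D₁ y‖ ≤ ε) (hx : ‖x‖ + ‖z‖ ≤ R) (hx' : ‖x'‖ + ‖z‖ ≤ R) :
    ‖(g₂ (x' + z') - g₂ x') - (g₁ (x + z) - g₁ x)‖ ≤
      L * ‖z' - z‖ + (M * ‖x' - x‖ ^ δ + ε) * ‖z‖ := by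
  have hder : ∀ θ : ℝ, HasDerivAt (fun θ : ℝ => g₂ (x' + θ • z) - g₁ (x + θ • z))
      (D₂ (x' + θ • z) z - D₁ (x + θ • z) z) θ := by
    intro θ
    have hl : ∀ w : F, HasDerivAt (fun θ : ℝ => w + θ • z) z θ := fun w => by
      simpa using ((hasDerivAt_id θ).smul_const z).const_add w
    exact ((h₂ _).comp_hasDerivAt θ (hl x')).sub ((h₁ _).comp_hasDerivAt θ (hl x))
  have hbd : ∀ θ ∈ Ico (0 : ℝ) 1, ‖D₂ (x' + θ • z) z - D₁ (x + θ • z) z‖ ≤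
      (M * ‖x' - x‖ ^ δ + ε) * ‖z‖ := by
    intro θ hθ
    have hn : ∀ w : F, ‖w‖ + ‖z‖ ≤ R → ‖w + θ • z‖ ≤ R := fun w hw => by
      refine (norm_add_le _ _).trans (le_trans ?_ hw)
      rw [norm_smul, Real.norm_of_nonneg hθ.1]
      nlinarith [hθ.2, norm_nonneg z]
    have e : D₂ (x' + θ • z) z - D₁ (x + θ • z) z =
        ((D₂ (x' + θ • z) - D₂ (x + θ • z)) + (D₂ (x + θ • z) - D₁ (x + θ • z))) z := by
      simp
    rw [e]
    refine (ContinuousLinearMap.le_opNorm _ _).trans ?_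
    gcongr
    refine (norm_add_le _ _).trans (add_le_add ?_ (hε _))
    have := hM (x' + θ • z) (x + θ • z) (hn _ hx') (hn _ hx)
    rwa [add_sub_add_right_eq_sub] at this
  have hmv := norm_image_sub_le_of_norm_deriv_le_segment_01'
    (fun θ _ => (hder θ).hasDerivWithinAt) hbd
  simp only [one_smul, zero_smul, add_zero] at hmv
  have e : (g₂ (x' + z') - g₂ x') - (g₁ (x + z) - g₁ x) =
      (g₂ (x' + z') - g₂ (x' + z)) + (g₂ (x' + z) - g₁ (x + z) - (g₂ x' - g₁ x)) := by abel
  rw [e]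
  refine (norm_add_le _ _).trans (add_le_add ?_ hmv)
  simpa using hL (x' + z') (x' + z)

/-- Coefficients of a Young differential equation whose regularity in time is measured by the
clock `τ`. -/
structure YoungCoeffs {E F : Type*} [NormedAddCommGroup E] [NormedSpace ℝ E]
    [NormedAddCommGroup F] [NormedSpace ℝ F] (A B κ γ : ℝ) (τ : ℝ → ℝ) (ω : ℝ → E)
    (f : ℝ → F → F) (g : ℝ → F → E →L[ℝ] F) (H L : ℝ) (Λ : ℝ → ℝ) : Prop where
  κ_lt : κ < 1
  γ_pos : 0 < γ
  γ_lt : γ < κ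
  one_lt : 1 < γ + κ
  H_nonneg : 0 ≤ H
  L_nonneg : 0 ≤ L
  τ_cont : ContinuousOn τ (Icc A B)
  τ_mono : StrictMonoOn τ (Icc A B)
  sub_le : ∀ s ∈ Icc A B, ∀ t ∈ Icc A B, s ≤ t → t - s ≤ τ t - τ s
  ω_le : ∀ s ∈ Icc A B, ∀ t ∈ Icc A B, s ≤ t → ‖ω t - ω s‖ ≤ (τ t - τ s) ^ κ
  g_le : ∀ s ∈ Icc A B, ∀ t ∈ Icc A B, s ≤ t → ∀ x y,
    ‖g t x - g s y‖ ≤ H * (τ t - τ s) ^ γ + L * ‖x - y‖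
  f_cont : ContinuousOn (fun z : ℝ × F => f z.1 z.2) (Icc A B ×ˢ univ)
  f_growth : ∀ s ∈ Icc A B, ∀ t ∈ Icc A B, s ≤ t → ∀ x,
    ‖∫ r in s..t, f r x‖ ≤ (‖x‖ + 1) * (τ t - τ s)
  Λ_nonneg : ∀ R, 0 ≤ R → 0 ≤ Λ R
  f_lip : ∀ R, 0 ≤ R → ∀ t ∈ Icc A B, ∀ x y, ‖x‖ ≤ R → ‖y‖ ≤ R →
    ‖f t x - f t y‖ ≤ Λ R * ‖x - y‖

namespace YoungCoeffs

variable {E F : Type*} [NormedAddCommGroup E] [NormedSpace ℝ E]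
  [NormedAddCommGroup F] [NormedSpace ℝ F] {A B κ γ : ℝ} {τ : ℝ → ℝ} {ω : ℝ → E}
  {f : ℝ → F → F} {g : ℝ → F → E →L[ℝ] F} {H L : ℝ} {Λ : ℝ → ℝ}

lemma κ_pos (h : YoungCoeffs A B κ γ τ ω f g H L Λ) : 0 < κ := h.γ_pos.trans h.γ_lt

lemma τ_sub_nonneg (h : YoungCoeffs A B κ γ τ ω f g H L Λ) {s t : ℝ} (hs : s ∈ Icc A B)
    (ht : t ∈ Icc A B) (hst : s ≤ t) : 0 ≤ τ t - τ s :=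
  sub_nonneg.2 (h.τ_mono.monotoneOn hs ht hst)

lemma τ_sub_le (h : YoungCoeffs A B κ γ τ ω f g H L Λ) {s t : ℝ} (hs : s ∈ Icc A B)
    (ht : t ∈ Icc A B) : τ t - τ s ≤ τ B - τ A := by
  have hAB := hs.1.trans hs.2
  have h1 := h.τ_mono.monotoneOn ⟨le_rfl, hAB⟩ hs hs.1
  have h2 := h.τ_mono.monotoneOn ht ⟨hAB, le_rfl⟩ ht.2
  linarith

lemma intervalIntegrable (h : YoungCoeffs A B κ γ τ ω f g H L Λ) {y : ℝ → F}
    (hy : ContinuousOn y (Icc A B)) {s t : ℝ} (hs : s ∈ Icc A B) (ht : t ∈ Icc A B) :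
    IntervalIntegrable (fun r => f r (y r)) MeasureTheory.volume s t := by
  have hc : ContinuousOn (fun r => f r (y r)) (Icc A B) :=
    h.f_cont.comp (f := fun r => (r, y r)) (continuousOn_id.prodMk hy) fun r hr => ⟨hr, mem_univ _⟩
  exact (hc.mono (ordConnected_Icc.uIcc_subset hs ht)).intervalIntegrable

lemma norm_integral_sub_le (h : YoungCoeffs A B κ γ τ ω f g H L Λ) {x y : ℝ → F} {R M s t : ℝ}
    (hR : 0 ≤ R) (hx : ContinuousOn x (Icc A B)) (hy : ContinuousOn y (Icc A B))
    (hs : s ∈ Icc A B) (ht : t ∈ Icc A B) (hst : s ≤ t)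
    (hxR : ∀ r ∈ Icc s t, ‖x r‖ ≤ R) (hyR : ∀ r ∈ Icc s t, ‖y r‖ ≤ R)
    (hM : ∀ r ∈ Icc s t, ‖x r - y r‖ ≤ M) :
    ‖(∫ r in s..t, f r (x r)) - ∫ r in s..t, f r (y r)‖ ≤ Λ R * M * (τ t - τ s) := by
  have hM0 : 0 ≤ M := (norm_nonneg _).trans (hM s ⟨le_rfl, hst⟩)
  have hΛ := h.Λ_nonneg R hR
  rw [← intervalIntegral.integral_sub (h.intervalIntegrable hx hs ht)
    (h.intervalIntegrable hy hs ht)]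
  have := intervalIntegral.norm_integral_le_of_norm_le_const (a := s) (b := t) (C := Λ R * M)
    (f := fun r => f r (x r) - f r (y r)) (fun r hr => by
      rw [uIoc_of_le hst] at hr
      have hr' := Ioc_subset_Icc_self hr
      refine (h.f_lip R hR r ⟨hs.1.trans hr'.1, hr'.2.trans ht.2⟩ _ _ (hxR r hr') (hyR r hr')).trans
        ?_
      gcongr
      exact hM r hr')
  refine this.trans ?_
  rw [abs_of_nonneg (sub_nonneg.2 hst)]
  exact mul_le_mul_of_nonneg_left (h.sub_le s hs t ht hst) (by positivity)

lemma roughData (h : YoungCoeffs A B κ γ τ ω f g H L Λ) (hAB : A ≤ B) :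
    RoughData A B κ γ τ ω g (fun s t x => ∫ r in s..t, f r x) H L
      (‖g A 0‖ + H * (τ B - τ A) ^ γ) Λ where
  κ_lt := h.κ_lt
  γ_pos := h.γ_pos
  γ_lt := h.γ_lt
  one_lt := h.one_lt
  H_nonneg := h.H_nonneg
  L_nonneg := h.L_nonneg
  G_nonneg := by
    have := h.τ_sub_nonneg ⟨le_rfl, hAB⟩ ⟨hAB, le_rfl⟩ hAB
    have := h.H_nonneg
    positivity
  τ_cont := h.τ_cont
  τ_mono := h.τ_mono
  ω_le := h.ω_le
  g_le := h.g_le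
  g_growth s hs x := by
    have hA : A ∈ Icc A B := ⟨le_rfl, hAB⟩
    have e : g s x = g A 0 + (g s x - g A 0) := by abel
    have h1 := h.g_le A hA s hs hs.1 x 0
    rw [sub_zero] at h1
    have h2 : (τ s - τ A) ^ γ ≤ (τ B - τ A) ^ γ :=
      Real.rpow_le_rpow (h.τ_sub_nonneg hA hs hs.1) (h.τ_sub_le hA hs) h.γ_pos.le
    have h3 := mul_le_mul_of_nonneg_left h2 h.H_nonneg
    rw [e]
    refine (norm_add_le _ _).trans ?_
    linarith
  drift_add s hs u hu t ht _ _ x := intervalIntegral.integral_add_adjacent_intervals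
    (h.intervalIntegrable continuousOn_const hs hu) (h.intervalIntegrable continuousOn_const hu ht)
  drift_growth := h.f_growth
  Λ_nonneg := h.Λ_nonneg
  drift_lip R hR s hs t ht hst x y hx hy := h.norm_integral_sub_le hR continuousOn_const
    continuousOn_const hs ht hst (fun _ _ => hx) (fun _ _ => hy) (fun _ _ => le_rfl)

/-- Composing the diffusion coefficient with a Hölder path. -/
lemma exists_comp_le (h : YoungCoeffs A B κ γ τ ω f g H L Λ) (hAB : A ≤ B) {y : ℝ → F} {C η : ℝ}
    (hC : 0 ≤ C) (hη : γ ≤ η)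
    (hy : ∀ s ∈ Icc A B, ∀ t ∈ Icc A B, s ≤ t → ‖y t - y s‖ ≤ C * (τ t - τ s) ^ η) :
    ∃ K, 0 ≤ K ∧ ∀ s ∈ Icc A B, ∀ t ∈ Icc A B, s ≤ t →
      ‖g t (y t) - g s (y s)‖ ≤ K * (τ t - τ s) ^ γ := by
  have hH := h.H_nonneg
  have hL := h.L_nonneg
  have hM := h.τ_sub_nonneg ⟨le_rfl, hAB⟩ ⟨hAB, le_rfl⟩ hAB
  refine ⟨H + L * (C * (τ B - τ A) ^ (η - γ)), by positivity, fun s hs t ht hst => ?_⟩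
  have hw := h.τ_sub_nonneg hs ht hst
  calc ‖g t (y t) - g s (y s)‖ ≤ H * (τ t - τ s) ^ γ + L * ‖y t - y s‖ := h.g_le s hs t ht hst _ _
    _ ≤ H * (τ t - τ s) ^ γ + L * (C * ((τ B - τ A) ^ (η - γ) * (τ t - τ s) ^ γ)) := by
        gcongr
        refine (hy s hs t ht hst).trans ?_
        gcongr
        exact rpow_le_mul_rpow hw (h.τ_sub_le hs ht) hη h.γ_pos
    _ = _ := by ring

/-- Existence of Hölder solutions. -/
theorem exists_solution [ProperSpace F] (h : YoungCoeffs A B κ γ τ ω f g H L Λ) (hAB : A ≤ B)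
    (x₀ : F) : ∃ y : ℝ → F, ∃ C, 0 ≤ C ∧ y A = x₀ ∧
      (∀ s ∈ Icc A B, ∀ t ∈ Icc A B, s ≤ t → ‖y t - y s‖ ≤ C * (τ t - τ s) ^ κ) ∧
      ∀ t ∈ Icc A B,
        y t = x₀ + (∫ r in A..t, f r (y r)) + youngIntegral (fun r => g r (y r)) ω A t := by
  obtain ⟨y, C, hC, hyA, hy⟩ := (h.roughData hAB).exists_davie hAB x₀
  have hyH : ∀ s ∈ Icc A B, ∀ t ∈ Icc A B, s ≤ t → ‖y t - y s‖ ≤ C * (τ t - τ s) ^ κ :=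
    fun s hs t ht hst => (hy s hs t ht hst).1
  refine ⟨y, C, hC, hyA, hyH, fun t₀ ht₀ => ?_⟩
  have hA : A ∈ Icc A B := ⟨le_rfl, hAB⟩
  have hM := h.τ_sub_nonneg hA ⟨hAB, le_rfl⟩ hAB
  have hκ := h.κ_pos
  have hγ := h.γ_pos
  have hyc := continuousOn_of_le_rpow hκ h.τ_cont h.τ_mono.monotoneOn hyH
  obtain ⟨R, hR⟩ := isCompact_Icc.exists_bound_of_continuousOn hyc
  have hR0 : 0 ≤ R := (norm_nonneg _).trans (hR A hA)
  have hΛ := h.Λ_nonneg R hR0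
  obtain ⟨K, hK, hgK⟩ := h.exists_comp_le hAB hC h.γ_lt.le hyH
  set M := τ B - τ A with hMdef
  set C' := C + Λ R * C * M ^ (1 - γ) with hC'
  have hC'0 : 0 ≤ C' := by positivity
  have hexp : ∀ s ∈ Icc A B, ∀ t ∈ Icc A B, s ≤ t →
      ‖(y t - ∫ r in A..t, f r (y r)) - (y s - ∫ r in A..s, f r (y r)) -
        g s (y s) (ω t - ω s)‖ ≤ C' * (τ t - τ s) ^ (γ + κ) := by
    intro s hs t ht hst
    have hw := h.τ_sub_nonneg hs ht hst
    have hadd := intervalIntegral.integral_add_adjacent_intervals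
      (h.intervalIntegrable hyc hA hs) (h.intervalIntegrable hyc hs ht)
    have hsub : Icc s t ⊆ Icc A B := Icc_subset_Icc hs.1 ht.2
    have h1 := (hy s hs t ht hst).2
    have h2 := h.norm_integral_sub_le (x := y) (y := fun _ => y s) (M := C * (τ t - τ s) ^ κ) hR0
      hyc continuousOn_const hs ht hst (fun r hr => hR r (hsub hr)) (fun _ _ => hR s hs)
      (fun r hr => (hyH s hs r (hsub hr) hr.1).trans (by
        have := h.τ_sub_nonneg hs (hsub hr) hr.1
        have := h.τ_mono.monotoneOn (hsub hr) ht hr.2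
        gcongr))
    have h3 : (τ t - τ s) ^ κ * (τ t - τ s) ≤ M ^ (1 - γ) * (τ t - τ s) ^ (γ + κ) := by
      have := rpow_le_mul_rpow hw (h.τ_sub_le hs ht)
        (show γ + κ ≤ κ + 1 by linarith [h.γ_lt, h.κ_lt]) (by linarith)
      rw [Real.rpow_add_of_nonneg hw hκ.le zero_le_one, Real.rpow_one] at this
      convert this using 3
      ring
    rw [← hadd]
    calc _ = ‖(y t - y s - g s (y s) (ω t - ω s) - ∫ r in s..t, f r (y s)) -
          ((∫ r in s..t, f r (y r)) - ∫ r in s..t, f r (y s))‖ := by congr 1; abel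
      _ ≤ C * (τ t - τ s) ^ (γ + κ) + Λ R * (C * (τ t - τ s) ^ κ) * (τ t - τ s) :=
          (norm_sub_le _ _).trans (add_le_add h1 h2)
      _ = C * (τ t - τ s) ^ (γ + κ) + Λ R * C * ((τ t - τ s) ^ κ * (τ t - τ s)) := by ring
      _ ≤ C * (τ t - τ s) ^ (γ + κ) + Λ R * C * (M ^ (1 - γ) * (τ t - τ s) ^ (γ + κ)) := by
          gcongr
      _ = C' * (τ t - τ s) ^ (γ + κ) := by rw [hC']; ring
  have hsub : Icc A t₀ ⊆ Icc A B := Icc_subset_Icc_right ht₀.2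
  have hI := isYoungIntegral_of_expansion (x := fun r => g r (y r)) (ω := ω)
    (z := fun t => y t - ∫ r in A..t, f r (y r)) (C := max C' K) ht₀.1 hκ hγ h.one_lt
    (le_max_of_le_left hC'0) (h.τ_cont.mono hsub) (h.τ_mono.monotoneOn.mono hsub)
    (fun s hs t ht hst => h.ω_le s (hsub hs) t (hsub ht) hst)
    (fun s hs t ht hst => (hgK s (hsub hs) t (hsub ht) hst).trans
      (mul_le_mul_of_nonneg_right (le_max_right _ _)
        (Real.rpow_nonneg (h.τ_sub_nonneg (hsub hs) (hsub ht) hst) _)))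
    (fun s hs t ht hst => (hexp s (hsub hs) t (hsub ht) hst).trans
      (mul_le_mul_of_nonneg_right (le_max_left _ _)
        (Real.rpow_nonneg (h.τ_sub_nonneg (hsub hs) (hsub ht) hst) _)))
  rw [IsYoungIntegral.youngIntegral_eq ht₀.1 hI, intervalIntegral.integral_same, hyA]
  abel

/-- Uniqueness among Hölder solutions. -/
theorem solution_unique [ProperSpace F] (h : YoungCoeffs A B κ γ τ ω f g H L Λ) (hAB : A ≤ B)
    {Dg : ℝ → F → F →L[ℝ] E →L[ℝ] F} {MN : ℝ → ℝ} {δ η : ℝ} (hδ : 0 < δ) (hMN : ∀ N, 0 ≤ N → 0 ≤ MN N)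
    (hDg : ∀ t ∈ Icc A B, ∀ x, HasFDerivAt (g t) (Dg t x) x)
    (hDg_holder : ∀ N, 0 ≤ N → ∀ t ∈ Icc A B, ∀ x y, ‖x‖ ≤ N → ‖y‖ ≤ N →
      ‖Dg t x - Dg t y‖ ≤ MN N * ‖x - y‖ ^ δ)
    (hDg_time : ∀ s ∈ Icc A B, ∀ t ∈ Icc A B, s ≤ t → ∀ x,
      ‖Dg t x - Dg s x‖ ≤ H * (τ t - τ s) ^ γ)
    (hη : γ ≤ η) (hδη : γ ≤ η * δ) {x₀ : F} {x y : ℝ → F} {C : ℝ} (hC : 0 ≤ C)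
    (hxH : ∀ s ∈ Icc A B, ∀ t ∈ Icc A B, s ≤ t → ‖x t - x s‖ ≤ C * (τ t - τ s) ^ η)
    (hyH : ∀ s ∈ Icc A B, ∀ t ∈ Icc A B, s ≤ t → ‖y t - y s‖ ≤ C * (τ t - τ s) ^ η)
    (hx : ∀ t ∈ Icc A B,
      x t = x₀ + (∫ r in A..t, f r (x r)) + youngIntegral (fun r => g r (x r)) ω A t)
    (hy : ∀ t ∈ Icc A B,
      y t = x₀ + (∫ r in A..t, f r (y r)) + youngIntegral (fun r => g r (y r)) ω A t) :
    ∀ t ∈ Icc A B, y t = x t := by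
  have hA : A ∈ Icc A B := ⟨le_rfl, hAB⟩
  have hM := h.τ_sub_nonneg hA ⟨hAB, le_rfl⟩ hAB
  have hκ := h.κ_pos
  have hγ := h.γ_pos
  have hη0 : 0 < η := hγ.trans_le hη
  have hL := h.L_nonneg
  have hH := h.H_nonneg
  have hxc := continuousOn_of_le_rpow hη0 h.τ_cont h.τ_mono.monotoneOn hxH
  have hyc := continuousOn_of_le_rpow hη0 h.τ_cont h.τ_mono.monotoneOn hyH
  obtain ⟨Rx, hRx⟩ := isCompact_Icc.exists_bound_of_continuousOn hxc
  obtain ⟨Ry, hRy⟩ := isCompact_Icc.exists_bound_of_continuousOn hyc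
  have hRx0 : 0 ≤ Rx := (norm_nonneg _).trans (hRx A hA)
  have hRy0 : 0 ≤ Ry := (norm_nonneg _).trans (hRy A hA)
  set R := Rx + (Ry + Rx) with hR
  have hR0 : 0 ≤ R := by positivity
  have hM0 := hMN R hR0
  obtain ⟨Kx, hKx, hgx⟩ := h.exists_comp_le hAB hC hη hxH
  obtain ⟨Ky, hKy, hgy⟩ := h.exists_comp_le hAB hC hη hyH
  obtain ⟨zx, Cx, hCx, hx0, hzx, hex⟩ := exists_young hAB h.κ_lt hγ h.γ_lt h.one_lt hKx h.τ_cont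
    h.τ_mono h.ω_le hgx
  obtain ⟨zy, Cy, hCy, hy0, hzy, hey⟩ := exists_young hAB h.κ_lt hγ h.γ_lt h.one_lt hKy h.τ_cont
    h.τ_mono h.ω_le hgy
  set M := τ B - τ A with hMdef
  have hz : ∀ s ∈ Icc A B, ‖y s - x s‖ ≤ Ry + Rx := fun s hs =>
    (norm_sub_le _ _).trans (add_le_add (hRy s hs) (hRx s hs))
  have key := eq_zero_of_linear_rough (z := fun t => y t - x t)
    (Ψ := fun t => (∫ r in A..t, f r (y r)) - ∫ r in A..t, f r (x r))
    (v := fun t => g t (y t) - g t (x t)) (ω := ω) (C := Cx + Cy + 2 * C * M ^ (η - γ)) (L := L)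
    (K := MN R * (C ^ δ * M ^ (η * δ - γ)) + H) (Λ := Λ R)
    h.κ_lt hγ h.γ_lt h.one_lt (by positivity) hL (by positivity) (h.Λ_nonneg R hR0) h.τ_cont
    h.τ_mono h.ω_le (hyc.sub hxc) ?_ ?_ ?_ ?_ ?_ ?_
  · exact fun t ht => sub_eq_zero.1 (key t ht)
  · intro s hs t ht hst
    have hw := h.τ_sub_nonneg hs ht hst
    have e : y t - x t - (y s - x s) = (y t - y s) - (x t - x s) := by abel
    have h1 := rpow_le_mul_rpow hw (h.τ_sub_le hs ht) hη hγ
    calc ‖y t - x t - (y s - x s)‖ ≤ C * (τ t - τ s) ^ η + C * (τ t - τ s) ^ η := by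
          rw [e]
          exact (norm_sub_le _ _).trans (add_le_add (hyH s hs t ht hst) (hxH s hs t ht hst))
      _ = 2 * C * (τ t - τ s) ^ η := by ring
      _ ≤ 2 * C * (M ^ (η - γ) * (τ t - τ s) ^ γ) := by gcongr
      _ = 2 * C * M ^ (η - γ) * (τ t - τ s) ^ γ := by ring
      _ ≤ _ := by
          gcongr
          linarith
  · intro s hs t ht hst
    have hw := h.τ_sub_nonneg hs ht hst
    have h1 := hey s hs t ht hst
    have h2 := hex s hs t ht hst
    calc _ = ‖(zy t - zy s - g s (y s) (ω t - ω s)) - (zx t - zx s - g s (x s) (ω t - ω s))‖ := by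
          have ey : ∀ t ∈ Icc A B, zy t = y t - x₀ - ∫ r in A..t, f r (y r) := fun t ht => by
            rw [← hzy t ht, hy t ht]; abel
          have ex : ∀ t ∈ Icc A B, zx t = x t - x₀ - ∫ r in A..t, f r (x r) := fun t ht => by
            rw [← hzx t ht, hx t ht]; abel
          rw [ey t ht, ey s hs, ex t ht, ex s hs, sub_apply]
          congr 1
          abel
      _ ≤ Cy * (τ t - τ s) ^ (γ + κ) + Cx * (τ t - τ s) ^ (γ + κ) :=
          (norm_sub_le _ _).trans (add_le_add h1 h2)
      _ = (Cx + Cy) * (τ t - τ s) ^ (γ + κ) := by ring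
      _ ≤ _ := by
          have : 0 ≤ 2 * C * M ^ (η - γ) := by positivity
          exact mul_le_mul_of_nonneg_right (by linarith) (by positivity)
  · intro s hs
    simpa [h.γ_pos.ne', Real.zero_rpow] using h.g_le s hs s hs le_rfl (y s) (x s)
  · intro s hs t ht hst
    have hw := h.τ_sub_nonneg hs ht hst
    have h1 := norm_second_difference_le (g₁ := g s) (g₂ := g t) (D₁ := Dg s) (D₂ := Dg t)
      (x := x s) (x' := x t) (z := y s - x s) (z' := y t - x t) (L := L) (R := R)
      (hDg s hs) (hDg t ht)
      (fun u u' => by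
        simpa [h.γ_pos.ne', Real.zero_rpow] using h.g_le t ht t ht le_rfl u u')
      (hDg_holder R hR0 t ht) (hDg_time s hs t ht hst)
      (add_le_add (hRx s hs) (hz s hs)) (add_le_add (hRx t ht) (hz s hs))
    simp only [add_sub_cancel] at h1
    refine h1.trans ((add_le_add_iff_left _).2 ?_)
    have h2 : ‖x t - x s‖ ^ δ ≤ C ^ δ * M ^ (η * δ - γ) * (τ t - τ s) ^ γ := by
      calc ‖x t - x s‖ ^ δ ≤ (C * (τ t - τ s) ^ η) ^ δ :=
            Real.rpow_le_rpow (norm_nonneg _) (hxH s hs t ht hst) hδ.le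
        _ = C ^ δ * (τ t - τ s) ^ (η * δ) := by
            rw [Real.mul_rpow hC (by positivity), Real.rpow_mul hw]
        _ ≤ C ^ δ * (M ^ (η * δ - γ) * (τ t - τ s) ^ γ) := by
            gcongr
            exact rpow_le_mul_rpow hw (h.τ_sub_le hs ht) hδη hγ
        _ = _ := by ring
    calc (MN R * ‖x t - x s‖ ^ δ + H * (τ t - τ s) ^ γ) * ‖y s - x s‖
        ≤ (MN R * (C ^ δ * M ^ (η * δ - γ) * (τ t - τ s) ^ γ) + H * (τ t - τ s) ^ γ) *
          ‖y s - x s‖ := by gcongr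
      _ = _ := by ring
  · intro s hs t ht hst N hN
    have hsub : Icc s t ⊆ Icc A B := Icc_subset_Icc hs.1 ht.2
    have e1 := intervalIntegral.integral_add_adjacent_intervals
      (h.intervalIntegrable hyc hA hs) (h.intervalIntegrable hyc hs ht)
    have e2 := intervalIntegral.integral_add_adjacent_intervals
      (h.intervalIntegrable hxc hA hs) (h.intervalIntegrable hxc hs ht)
    have := h.norm_integral_sub_le (x := y) (y := x) (R := R) (M := N) hR0 hyc hxc hs ht hst
      (fun r hr => (hRy r (hsub hr)).trans (by linarith))
      (fun r hr => (hRx r (hsub hr)).trans (by linarith)) hN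
    rw [← e1, ← e2]
    convert this using 2
    abel
  · rw [hy A hA, hx A hA, hzy A hA, hzx A hA, hx0, hy0]
    simp

end YoungCoeffs

lemma intervalIntegrable_abs_of_rpow {b : ℝ → ℝ} {e s t : ℝ} (he : 1 ≤ e)
    (h : IntervalIntegrable (fun r => |b r| ^ e) MeasureTheory.volume s t) :
    IntervalIntegrable (fun r => |b r|) MeasureTheory.volume s t := by
  have he0 : 0 < e := by linarith
  have e1 : (fun r => (|b r| ^ e) ^ e⁻¹) = fun r => |b r| := by
    funext r
    rw [← Real.rpow_mul (abs_nonneg _), mul_inv_cancel₀ he0.ne', Real.rpow_one]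
  have hm := ((intervalIntegrable_iff.1 h).aestronglyMeasurable.aemeasurable.pow_const e⁻¹).aestronglyMeasurable
  rw [e1] at hm
  refine ((intervalIntegrable_const (c := (1 : ℝ))).add h).mono_fun hm
    (Filter.Eventually.of_forall fun r => ?_)
  have h0 : 0 ≤ |b r| ^ e := by positivity
  change ‖|b r|‖ ≤ ‖1 + |b r| ^ e‖
  rw [Real.norm_eq_abs, abs_abs, Real.norm_of_nonneg (by linarith)]
  rcases le_total |b r| 1 with h1 | h1
  · linarith
  · have := Real.rpow_le_rpow_of_exponent_le h1 he
    rw [Real.rpow_one] at this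
    linarith

/-- Theorem `theo2`, existence and uniqueness of the global solution:
under (H1)–(H3), for any initial time `t0 ∈ [0,T)` and initial value `x0`, the Young
differential equation has a unique solution of finite `q`-variation on `[t0,T]`; moreover,
this solution has finite `p'`-variation with `p' = max{p, 1/α}`. -/
theorem stmt13
    {d m : ℕ} (p T : ℝ) (hp1 : 1 < p) (hp2 : p < 2) (hT : 0 < T)
    (f : ℝ → Ed d → Ed d) (g : ℝ → Ed d → (Ed m →L[ℝ] Ed d))
    (hf : ContinuousOn (fun pr : ℝ × Ed d => f pr.1 pr.2) (Set.Icc 0 T ×ˢ Set.univ))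
    (hg : ContinuousOn (fun pr : ℝ × Ed d => g pr.1 pr.2) (Set.Icc 0 T ×ˢ Set.univ))
    (Dg : ℝ → Ed d → (Ed d →L[ℝ] Ed m →L[ℝ] Ed d))
    (hDg : ∀ t ∈ Set.Icc (0:ℝ) T, ∀ x : Ed d, HasFDerivAt (g t) (Dg t x) x)
    (β δ Lg : ℝ) (hβ0 : 0 < β) (hβ1 : β ≤ 1) (hδ0 : 0 < δ) (hδ1 : δ ≤ 1) (hLg : 0 < Lg)
    (h : ℝ → ℝ → ℝ) (hctrl : IsControlOn 0 T h)
    (MN : ℝ → ℝ) (hMN : ∀ N : ℝ, 0 ≤ N → 0 < MN N)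
    (H1i : ∀ t ∈ Set.Icc (0:ℝ) T, ∀ x y : Ed d, ‖g t x - g t y‖ ≤ Lg * ‖x - y‖)
    (H1ii : ∀ N : ℝ, 0 ≤ N → ∀ t ∈ Set.Icc (0:ℝ) T, ∀ x y : Ed d, ‖x‖ ≤ N → ‖y‖ ≤ N →
      ‖Dg t x - Dg t y‖ ≤ MN N * ‖x - y‖ ^ δ)
    (H1iii : ∀ s t : ℝ, 0 ≤ s → s < t → t ≤ T → ∀ x : Ed d,
      ‖g t x - g s x‖ + ‖Dg t x - Dg s x‖ ≤ h s t ^ β)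
    (a α : ℝ) (b : ℝ → ℝ) (ha : 0 < a) (hα1 : 1 / 2 ≤ α) (hα2 : α < 1)
    (hbmem : IntervalIntegrable (fun s => |b s| ^ (1 / (1 - α))) MeasureTheory.volume 0 T)
    (LN : ℝ → ℝ) (hLN : ∀ N : ℝ, 0 ≤ N → 0 < LN N)
    (H2i : ∀ N : ℝ, 0 ≤ N → ∀ t ∈ Set.Icc (0:ℝ) T, ∀ x y : Ed d, ‖x‖ ≤ N → ‖y‖ ≤ N →
      ‖f t x - f t y‖ ≤ LN N * ‖x - y‖)
    (H2ii : ∀ t ∈ Set.Icc (0:ℝ) T, ∀ x : Ed d, ‖f t x‖ ≤ a * ‖x‖ + b t)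
    (H3a : p - 1 < δ) (H3b : 1 - 1 / p < β) (H3c : 1 - 1 / p < δ * α)
    (q0 q : ℝ)
    (hq0a : 1 - 1 / p < 1 / q0)
    (hq0b : 1 / q0 < min (min β (δ * α)) (min (δ / p) (1 / 2)))
    (hqa : 1 / (q0 * δ) ≤ 1 / q) (hqb : 1 / q < min α (1 / p))
    (ω : ℝ → Ed m) (hω : ContinuousOn ω (Set.Icc 0 T)) (hωp : FinitePVar p ω 0 T)
    (t0 : ℝ) (ht0 : 0 ≤ t0) (ht0T : t0 < T) (x0 : Ed d) :
    ∃ x : ℝ → Ed d, IsSolutionOn f g ω q t0 T x0 x ∧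
      FinitePVar (max p (1 / α)) x t0 T ∧
      ∀ y : ℝ → Ed d, IsSolutionOn f g ω q t0 T x0 y →
        ∀ t ∈ Set.Icc t0 T, y t = x t := by
  have hp0 : 0 < p := by linarith
  have hκ : 0 < 1 / p := by positivity
  have hκ1 : 1 / p < 1 := by rw [div_lt_one hp0]; exact hp1
  have hγ0 : 0 < 1 / q0 := by linarith
  have hq0 : 0 < q0 := one_div_pos.1 hγ0
  obtain ⟨hq0c, hq0d⟩ := lt_min_iff.1 hq0b
  obtain ⟨hγβ, -⟩ := lt_min_iff.1 hq0c
  obtain ⟨hγδp, -⟩ := lt_min_iff.1 hq0d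
  have hγκ : 1 / q0 < 1 / p := hγδp.trans_le (div_le_div_of_nonneg_right hδ1 hp0.le)
  have hqi : 0 < 1 / q := lt_of_lt_of_le (by positivity) hqa
  have hq : 0 < q := one_div_pos.1 hqi
  have hγδq : 1 / q0 ≤ 1 / q * δ := by
    have := mul_le_mul_of_nonneg_right hqa hδ0.le
    calc 1 / q0 = 1 / (q0 * δ) * δ := by field_simp
      _ ≤ _ := this
  have hγq : 1 / q0 ≤ 1 / q := hγδq.trans (mul_le_of_le_one_right hqi.le hδ1)
  have hκq : 1 ≤ 1 / p * q := by
    have : 1 / q * q < 1 / p * q := mul_lt_mul_of_pos_right (hqb.trans_le (min_le_right _ _)) hq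
    rw [one_div_mul_cancel hq.ne'] at this
    exact this.le
  have hsub : Icc t0 T ⊆ Icc 0 T := Icc_subset_Icc_left ht0
  have ht0I : t0 ∈ Icc t0 T := ⟨le_rfl, ht0T.le⟩
  have hTI : T ∈ Icc t0 T := ⟨ht0T.le, le_rfl⟩
  -- the clock attached to the data
  have hbI : IntervalIntegrable (fun r => |b r|) MeasureTheory.volume t0 T := by
    refine (intervalIntegrable_abs_of_rpow ?_ hbmem).mono_set
      (by rw [uIcc_of_le ht0T.le, uIcc_of_le hT.le]; exact hsub)
    rw [le_div_iff₀ (by linarith)]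
    linarith
  have hbst : ∀ s ∈ Icc t0 T, ∀ t ∈ Icc t0 T,
      IntervalIntegrable (fun r => |b r|) MeasureTheory.volume s t := fun s hs t ht =>
    hbI.mono_set (by rw [uIcc_of_le ht0T.le]; exact ordConnected_Icc.uIcc_subset hs ht)
  obtain ⟨V, hVc, hVm, hV⟩ := exists_clock hp0 hω hωp
  obtain ⟨σ, hσ⟩ : ∃ σ : ℝ → ℝ, σ = fun t => V t + h t0 t + (1 + a) * t + ∫ r in t0..t, |b r| :=
    ⟨_, rfl⟩
  have hσc : ContinuousOn σ (Icc t0 T) := by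
    rw [hσ]
    refine (((hVc.mono hsub).add ?_).add (continuousOn_const.mul continuousOn_id)).add ?_
    · exact hctrl.1.comp (f := fun t => (t0, t)) (continuousOn_const.prodMk continuousOn_id)
        fun t ht => ⟨ht0, ht.1, ht.2⟩
    · have := intervalIntegral.continuousOn_primitive_interval' hbI left_mem_uIcc
      rwa [uIcc_of_le ht0T.le] at this
  have hσsub : ∀ s ∈ Icc t0 T, ∀ t ∈ Icc t0 T, s ≤ t →
      ‖ω t - ω s‖ ^ p + h s t + (t - s) + (a * (t - s) + ∫ r in s..t, |b r|) ≤ σ t - σ s := by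
    intro s hs t ht hst
    have e1 := hV s (hsub hs) t (hsub ht) hst
    have e2 := hctrl.2.2.1 t0 s t ht0 hs.1 hst ht.2
    have e3 := intervalIntegral.integral_add_adjacent_intervals (hbst t0 ht0I s hs) (hbst s hs t ht)
    rw [hσ]
    simp only
    rw [← e3]
    linarith
  have hterms : ∀ s ∈ Icc t0 T, ∀ t ∈ Icc t0 T, s ≤ t → 0 ≤ ‖ω t - ω s‖ ^ p ∧ 0 ≤ h s t ∧
      0 ≤ t - s ∧ 0 ≤ a * (t - s) ∧ 0 ≤ ∫ r in s..t, |b r| := fun s hs t ht hst =>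
    ⟨by positivity, hctrl.2.2.2 s t (hsub hs).1 hst ht.2, sub_nonneg.2 hst,
      mul_nonneg ha.le (sub_nonneg.2 hst),
      intervalIntegral.integral_nonneg hst fun _ _ => abs_nonneg _⟩
  have hσm : StrictMonoOn σ (Icc t0 T) := by
    intro s hs t ht hst
    obtain ⟨e1, e2, -, e4, e5⟩ := hterms s hs t ht hst.le
    have := hσsub s hs t ht hst.le
    linarith
  -- any clock dominating `σ` is admissible
  have hmk : ∀ W : ℝ → ℝ, ContinuousOn W (Icc t0 T) → MonotoneOn W (Icc t0 T) →
      ∃ H, YoungCoeffs t0 T (1 / p) (1 / q0) (fun t => σ t + W t) ω f g H Lg LN ∧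
        ∀ s ∈ Icc t0 T, ∀ t ∈ Icc t0 T, s ≤ t → ∀ x,
          ‖Dg t x - Dg s x‖ ≤ H * ((σ t + W t) - (σ s + W s)) ^ (1 / q0) := by
    intro W hWc hWm
    have hle : ∀ s ∈ Icc t0 T, ∀ t ∈ Icc t0 T, s ≤ t →
        σ t - σ s ≤ (σ t + W t) - (σ s + W s) := fun s hs t ht hst => by
      linarith [hWm hs ht hst]
    have hτm : StrictMonoOn (fun t => σ t + W t) (Icc t0 T) := hσm.add_monotone hWm
    obtain ⟨M, hM⟩ : ∃ M, M = (σ T + W T) - (σ t0 + W t0) := ⟨_, rfl⟩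
    have hM0 : 0 ≤ M := by rw [hM]; exact sub_nonneg.2 (hτm.monotoneOn ht0I hTI ht0T.le)
    have htime : ∀ s ∈ Icc t0 T, ∀ t ∈ Icc t0 T, s ≤ t → ∀ x,
        ‖g t x - g s x‖ ≤ M ^ (β - 1 / q0) * ((σ t + W t) - (σ s + W s)) ^ (1 / q0) ∧
        ‖Dg t x - Dg s x‖ ≤ M ^ (β - 1 / q0) * ((σ t + W t) - (σ s + W s)) ^ (1 / q0) := by
      intro s hs t ht hst x
      have hw : 0 ≤ (σ t + W t) - (σ s + W s) := sub_nonneg.2 (hτm.monotoneOn hs ht hst)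
      have hwM : (σ t + W t) - (σ s + W s) ≤ M := by
        have h1 := hτm.monotoneOn ht0I hs hs.1
        have h2 := hτm.monotoneOn ht hTI ht.2
        linarith
      have hh : h s t ^ β ≤ M ^ (β - 1 / q0) * ((σ t + W t) - (σ s + W s)) ^ (1 / q0) := by
        refine le_trans ?_ (rpow_le_mul_rpow hw hwM hγβ.le hγ0)
        obtain ⟨e1, e2, e3, e4, e5⟩ := hterms s hs t ht hst
        refine Real.rpow_le_rpow e2 ?_ hβ0.le
        linarith [hσsub s hs t ht hst, hle s hs t ht hst]
      have h0 : 0 ≤ M ^ (β - 1 / q0) * ((σ t + W t) - (σ s + W s)) ^ (1 / q0) := by positivity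
      rcases hst.eq_or_lt with rfl | hst
      · refine ⟨?_, ?_⟩
        · rw [sub_self (g s x), norm_zero]
          exact h0
        · rw [sub_self (Dg s x)]
          exact (norm_zero (E := Ed d →L[ℝ] Ed m →L[ℝ] Ed d)).trans_le h0
      · have h1 := H1iii s t (hsub hs).1 hst ht.2 x
        constructor
        · linarith [norm_nonneg (Dg t x - Dg s x)]
        · linarith [norm_nonneg (g t x - g s x)]
    refine ⟨M ^ (β - 1 / q0), ?_, fun s hs t ht hst x => (htime s hs t ht hst x).2⟩
    exact
      { κ_lt := hκ1
        γ_pos := hγ0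
        γ_lt := hγκ
        one_lt := by linarith
        H_nonneg := by positivity
        L_nonneg := hLg.le
        τ_cont := hσc.add hWc
        τ_mono := hτm
        sub_le := fun s hs t ht hst => by
          obtain ⟨e1, e2, e3, e4, e5⟩ := hterms s hs t ht hst
          linarith [hσsub s hs t ht hst, hle s hs t ht hst]
        ω_le := fun s hs t ht hst => by
          obtain ⟨e1, e2, e3, e4, e5⟩ := hterms s hs t ht hst
          have e : ‖ω t - ω s‖ = (‖ω t - ω s‖ ^ p) ^ (1 / p) := by
            rw [← Real.rpow_mul (norm_nonneg _), mul_one_div_cancel hp0.ne', Real.rpow_one]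
          rw [e]
          refine Real.rpow_le_rpow e1 ?_ hκ.le
          linarith [hσsub s hs t ht hst, hle s hs t ht hst]
        g_le := fun s hs t ht hst x y => by
          have e : g t x - g s y = (g t y - g s y) + (g t x - g t y) := by abel
          rw [e]
          exact (norm_add_le _ _).trans
            (add_le_add (htime s hs t ht hst y).1 (H1i t (hsub ht) x y))
        f_cont := hf.mono (prod_mono hsub Subset.rfl)
        f_growth := fun s hs t ht hst x => by
          obtain ⟨e1, e2, e3, e4, e5⟩ := hterms s hs t ht hst
          have hint : IntervalIntegrable (fun r => a * ‖x‖ + |b r|) MeasureTheory.volume s t :=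
            intervalIntegrable_const.add (hbst s hs t ht)
          have h1 : ‖∫ r in s..t, f r x‖ ≤ ∫ r in s..t, (a * ‖x‖ + |b r|) :=
            intervalIntegral.norm_integral_le_of_norm_le hst
              (Filter.Eventually.of_forall fun r hr =>
                (H2ii r (hsub ⟨hs.1.trans hr.1.le, hr.2.trans ht.2⟩) x).trans
                  ((add_le_add_iff_left _).2 (le_abs_self _))) hint
          rw [intervalIntegral.integral_add intervalIntegrable_const (hbst s hs t ht),
            intervalIntegral.integral_const, smul_eq_mul] at h1
          have h2 : a * (t - s) + (∫ r in s..t, |b r|) ≤ (σ t + W t) - (σ s + W s) := by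
            linarith [hσsub s hs t ht hst, hle s hs t ht hst]
          have h3 := mul_le_mul_of_nonneg_left h2 (show 0 ≤ ‖x‖ + 1 by positivity)
          have h4 := mul_nonneg (norm_nonneg x) e5
          linarith
        Λ_nonneg := fun R hR => (hLN R hR).le
        f_lip := fun R hR t ht x y hx hy => H2i R hR t (hsub ht) x y hx hy }
  obtain ⟨H, hdata, -⟩ := hmk (fun _ => 0) continuousOn_const monotoneOn_const
  obtain ⟨x, C, hC, hx0, hxH, hx⟩ := hdata.exists_solution ht0T.le x0
  have hxsol : IsSolutionOn f g ω q t0 T x0 x :=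
    ⟨continuousOn_of_le_rpow hκ hdata.τ_cont hdata.τ_mono.monotoneOn hxH,
      finitePVar_of_le hC hq hκq hdata.τ_mono.monotoneOn hxH, hx0, hx⟩
  refine ⟨x, hxsol, ?_, fun y hy => ?_⟩
  · refine finitePVar_of_le hC (lt_max_of_lt_left hp0) ?_ hdata.τ_mono.monotoneOn hxH
    calc (1 : ℝ) = 1 / p * p := (one_div_mul_cancel hp0.ne').symm
      _ ≤ _ := mul_le_mul_of_nonneg_left (le_max_left _ _) hκ.le
  · obtain ⟨Vx, hVxc, hVxm, hVx⟩ := exists_clock hq hxsol.1 hxsol.2.1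
    obtain ⟨Vy, hVyc, hVym, hVy⟩ := exists_clock hq hy.1 hy.2.1
    obtain ⟨H', hdata', hDtime⟩ := hmk (fun t => Vx t + Vy t) (hVxc.add hVyc) (hVxm.add hVym)
    have hholder : ∀ z : ℝ → Ed d, (∀ s ∈ Icc t0 T, ∀ t ∈ Icc t0 T, s ≤ t →
        ‖z t - z s‖ ^ q ≤ (Vx t + Vy t) - (Vx s + Vy s)) →
        ∀ s ∈ Icc t0 T, ∀ t ∈ Icc t0 T, s ≤ t →
          ‖z t - z s‖ ≤ 1 * ((σ t + (Vx t + Vy t)) - (σ s + (Vx s + Vy s))) ^ (1 / q) := by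
      intro z hz s hs t ht hst
      have e : ‖z t - z s‖ = (‖z t - z s‖ ^ q) ^ (1 / q) := by
        rw [← Real.rpow_mul (norm_nonneg _), mul_one_div_cancel hq.ne', Real.rpow_one]
      rw [e, one_mul]
      refine Real.rpow_le_rpow (by positivity) ?_ hqi.le
      linarith [hz s hs t ht hst, hσm.monotoneOn hs ht hst]
    exact hdata'.solution_unique ht0T.le hδ0 (fun N hN => (hMN N hN).le)
      (fun t ht => hDg t (hsub ht)) (fun N hN t ht => H1ii N hN t (hsub ht)) hDtime hγq hγδq
      zero_le_one
      (hholder x fun s hs t ht hst => by linarith [hVx s hs t ht hst, hVym hs ht hst])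
      (hholder y fun s hs t ht hst => by linarith [hVy s hs t ht hst, hVxm hs ht hst])
      hxsol.2.2.2 hy.2.2.2
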